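/- arXiv:0905.0243 — 4 statements merged into one kernel-verified Lean document; each statement's English description precedes it below -/
import Mathlib

section
/- Let α be a multi-index and write α* = (α*_1,…,α*_t) for its dual. Then for every z ∈ ℂ with Re z > −α*_1, the Newton series F_α(z) converges and F_α(z) = G_{α'}(z), where α' = (α*)^τ. -/
open scoped BigOperators

/-- A multi-index: a nonempty finite sequence of positive integers. -/
def MIdx (α : List ℕ) : Prop := α ≠ [] ∧ ∀ a ∈ α, 1 ≤ a

/-- The set `S_m(α) = {α₁, α₁+α₂, …, α₁+⋯+α_{s-1}} ⊆ {1,…,m-1}` of proper partial sums. -/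
def boundarySet (α : List ℕ) : Finset ℕ :=
  (((List.scanl (· + ·) 0 α).drop 1).dropLast).toFinset

def diffAux : ℕ → List ℕ → List ℕ
  | _, [] => []
  | p, a :: t => (a - p) :: diffAux a t

/-- The dual multi-index `α*`. -/
def dualIdx (α : List ℕ) : List ℕ :=
  diffAux 0 ((insert α.sum (Finset.Icc 1 (α.sum - 1) \ boundarySet α)).sort (· ≤ ·))

/-- The finite multiple harmonic sum
`S_α(n) = Σ_{n > n₁ ≥ ⋯ ≥ n_s ≥ 0} 1/((n₁+1)^{α₁} ⋯ (n_s+1)^{α_s})`. -/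
noncomputable def hsum : List ℕ → ℕ → ℝ
  | [], _ => 1
  | a :: t, n => ∑ m ∈ Finset.range n, (1 / ((m : ℝ) + 1) ^ a) * hsum t (m + 1)

open Classical in
/-- The summand of the multiple series `G_α(z)`, indexed by tuples
`v : Fin |α| → ℕ`; it vanishes unless all `v j` are positive and the chain of
comparisons dictated by `α` holds (strict within blocks, weak between blocks). -/
noncomputable def Gterm (α : List ℕ) (z : ℂ) (v : Fin α.sum → ℕ) : ℂ :=
  if (∀ j, 0 < v j) ∧ (∀ j k : Fin α.sum, (k : ℕ) = (j : ℕ) + 1 →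
        (if (k : ℕ) ∈ boundarySet α then v k ≤ v j else v k < v j))
  then ∏ j : Fin α.sum, (if (j : ℕ) = 0 then (1 / (v j : ℂ) - 1 / ((v j : ℂ) + z))
             else if (j : ℕ) ∈ boundarySet α then 1 / ((v j : ℂ) + z)
             else 1 / (v j : ℂ))
  else 0

/-- The multiple series `G_α(z)`. -/
noncomputable def Gfun (α : List ℕ) (z : ℂ) : ℂ := ∑' v : Fin α.sum → ℕ, Gterm α z v

/-- `⁻α` : remove 1 from the first entry. -/
def lminus (α : List ℕ) : List ℕ :=
  match α with
  | [] => []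
  | a :: t => if 2 ≤ a then (a - 1) :: t else t

/-- `α⁻` : remove 1 from the last entry. -/
def rminus (α : List ℕ) : List ℕ :=
  if 2 ≤ α.getLastD 0 then α.dropLast ++ [α.getLastD 0 - 1] else α.dropLast

/-- The difference operator `(Δa)(n) = a(n) - a(n+1)`. -/
def delOp (a : ℕ → ℂ) : ℕ → ℂ := fun n => a n - a (n + 1)

/-- The inversion operator `(∇a)(n) = (Δⁿa)(0)`. -/
def nablaOp (a : ℕ → ℂ) : ℕ → ℂ := fun n => delOp^[n] a 0

/-- The generalized binomial coefficient `z(z-1)⋯(z-n+1)/n!`. -/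
noncomputable def cbinom (z : ℂ) (n : ℕ) : ℂ :=
  (∏ i ∈ Finset.range n, (z - (i : ℂ))) / (n.factorial : ℂ)

/-- The Newton series with coefficients `c` converges at `z` to `L`. -/
def NewtonSeriesTo (c : ℕ → ℂ) (z L : ℂ) : Prop :=
  Filter.Tendsto (fun N => ∑ n ∈ Finset.range N, (-1 : ℂ) ^ n * c n * cbinom z n)
    Filter.atTop (nhds L)

/-- The Newton series interpolating the sequence `a` converges at `z` to `L`. -/
def NewtonSumsTo (a : ℕ → ℂ) (z L : ℂ) : Prop := NewtonSeriesTo (nablaOp a) z L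

open Classical in
/-- `ζ_α(μ)` : the nested sum over tuples patterned on `α` with exponents `μ`. -/
noncomputable def zetaIdx (α : List ℕ) (μ : List ℕ) : ℝ :=
  ∑' v : Fin α.sum → ℕ,
    if (∀ j, 0 < v j) ∧ (∀ j k : Fin α.sum, (k : ℕ) = (j : ℕ) + 1 →
          (if (k : ℕ) ∈ boundarySet α then v k ≤ v j else v k < v j))
    then ∏ j : Fin α.sum, (1 : ℝ) / (v j : ℝ) ^ (μ.getD (j : ℕ) 1)
    else 0

/-- The multiple zeta value `ζ(μ) = ζ_{(p)}(μ)`. -/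
noncomputable def MZV (μ : List ℕ) : ℝ := zetaIdx [μ.length] μ

/-- `⁺μ` : add 1 to the first entry. -/
def mplus : List ℕ → List ℕ
  | [] => []
  | a :: t => (a + 1) :: t

/-- `ζ` extended ℚ-linearly to the vector space with basis the multi-indices. -/
noncomputable def zetaLin (v : List ℕ →₀ ℚ) : ℝ := v.sum fun μ c => (c : ℝ) * MZV μ

/-- `ζ⁺(μ) = ζ(⁺μ)`, extended ℚ-linearly. -/
noncomputable def zetaPlusLin (v : List ℕ →₀ ℚ) : ℝ := v.sum fun μ c => (c : ℝ) * MZV (mplus μ)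

/-- All ways of splitting a list into consecutive nonempty blocks. -/
def splits : List ℕ → List (List (List ℕ))
  | [] => [[]]
  | a :: t =>
      (splits t).map (fun c => [a] :: c) ++
      (splits t).filterMap (fun c =>
        match c with
        | [] => none
        | b :: r => some ((a :: b) :: r))

/-- `d(α) = Σ_{β ≤ α} β`, the sum over all coarsenings of `α`. -/
noncomputable def dmap (α : List ℕ) : List ℕ →₀ ℚ :=
  ((splits α).map fun c => Finsupp.single (c.map List.sum) (1 : ℚ)).sum

/-- All compositions of `n` into positive parts. -/
def comps : ℕ → List (List ℕ)
  | 0 => [[]]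
  | n + 1 => (List.range (n + 1)).flatMap fun j => (comps (n - j)).map fun c => (j + 1) :: c

/-- All refinements of `α`. -/
def refts : List ℕ → List (List ℕ)
  | [] => [[]]
  | a :: t => (comps a).flatMap fun c => (refts t).map fun β => c ++ β

/-- `u(α) = Σ_{β ≥ α} β`, the sum over all refinements of `α`. -/
noncomputable def umap (α : List ℕ) : List ℕ →₀ ℚ :=
  ((refts α).map fun β => Finsupp.single β (1 : ℚ)).sum

/-- The harmonic (quasi-shuffle) product on multi-indices, with values in the
ℚ-vector space with basis the multi-indices. -/
noncomputable def hprod : List ℕ → List ℕ → (List ℕ →₀ ℚ)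
  | [], u => Finsupp.single u 1
  | a :: s, [] => Finsupp.single (a :: s) 1
  | a :: s, b :: t =>
      Finsupp.mapDomain (List.cons a) (hprod s (b :: t)) +
      Finsupp.mapDomain (List.cons b) (hprod (a :: s) t) +
      Finsupp.mapDomain (List.cons (a + b)) (hprod s t)
  termination_by l₁ l₂ => l₁.length + l₂.length

/-- `α ⊛ β = (α₁+β₁) # (⁻α ∗ ⁻β)`. -/
noncomputable def circAst : List ℕ → List ℕ → (List ℕ →₀ ℚ)
  | a :: s, b :: t =>
      Finsupp.mapDomain (List.cons (a + b)) (hprod (lminus (a :: s)) (lminus (b :: t)))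
  | _, _ => 0

/-- `⊛` extended linearly in the first argument. -/
noncomputable def circAstLin (v : List ℕ →₀ ℚ) (β : List ℕ) : List ℕ →₀ ℚ :=
  v.sum fun γ c => c • circAst γ β

/-- The exponent list `(k₁+1,1,…,1, k₂+1,1,…,1, …, k_s+1,1,…,1)`, the `i`-th block
having length `α_i`. -/
def blockList (α : List ℕ) (ks : Fin α.length → ℕ) : List ℕ :=
  (List.ofFn fun i => (ks i + 1) :: List.replicate (α.get i - 1) 1).flatten

/-- `Q_r(n₁,…,n_r; z) = 1/((n₁+z)⋯(n_r+z))`, with `Q_0 = 1`. -/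
noncomputable def Qprod (l : List ℕ) (z : ℂ) : ℂ := (l.map fun n => 1 / ((n : ℂ) + z)).prod

/-- `R_r(n₁,…,n_r) = 1/(n₁⋯n_r)`, with `R_0 = 1`. -/
noncomputable def Rprod (l : List ℕ) : ℂ := (l.map fun n => 1 / (n : ℂ)).prod

/-- A block of `len` variables of factor type `fTy` (1 = Q-type, 2 = R-type); the first
carries the comparison `joinWeak` to the previous variable, subsequent ones carry the
block-internal comparison (weak inside Q-blocks, strict inside R-blocks). -/
def blockPart (fTy : ℕ) (joinWeak : Bool) : ℕ → List (ℕ × Bool)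
  | 0 => []
  | m + 1 => (fTy, joinWeak) :: List.replicate m (fTy, fTy == 1)

/-- The word of (factor type, comparison) pairs describing a `Φ`-sum: `qr` is the
weakness of the `□'` joins (Q-block to R-block) and `rq` that of the `□` joins
(R-block to next Q-block). -/
def mkWord (qr rq : Bool) (gs : List (ℕ × ℕ)) : List (ℕ × Bool) :=
  gs.flatMap fun g => blockPart 1 rq g.1 ++ blockPart 2 qr g.2

/-- The word of a `Φ`-sum: the very first factor is of `Q̃`-type (coded 0). -/
def phiWord (qr rq : Bool) (gs : List (ℕ × ℕ)) : List (ℕ × Bool) :=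
  match mkWord qr rq gs with
  | [] => []
  | (_, b) :: t => (0, b) :: t

open Classical in
/-- The nested sum `Φ_z` attached to a word `w` of (factor type, comparison) pairs:
factor type 0 gives `1/n - 1/(n+z)`, type 1 gives `1/(n+z)`, type 2 gives `1/n`;
comparison `true` means `≥`, `false` means `>`. -/
noncomputable def PhiSum (w : List (ℕ × Bool)) (z : ℂ) : ℂ :=
  ∑' v : Fin w.length → ℕ,
    if (∀ j, 0 < v j) ∧ (∀ j k : Fin w.length, (k : ℕ) = (j : ℕ) + 1 →
          (if (w.get k).2 then v k ≤ v j else v k < v j))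
    then ∏ j : Fin w.length, (if (w.get j).1 = 0 then (1 / (v j : ℂ) - 1 / ((v j : ℂ) + z))
               else if (w.get j).1 = 1 then 1 / ((v j : ℂ) + z)
               else 1 / (v j : ℂ))
    else 0



section NewtonAux

/-- The weighted harmonic chain attached to a set of boundaries, read from the top. -/
noncomputable def sWp (B : Finset ℕ) : ℕ → ℕ → ℂ
  | 0, n => 1 / ((n : ℂ) + 1)
  | m + 1, n => (1 / ((n : ℂ) + 1)) *
      (if m + 1 ∈ B then ∑ k ∈ Finset.range (n + 1), sWp B m k else sWp B m n)

lemma iter_delOp_succ (a : ℕ → ℂ) (n i : ℕ) :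
    delOp^[n + 1] a i = delOp^[n] a i - delOp^[n] a (i + 1) := by
  rw [Function.iterate_succ_apply']; rfl

lemma iter_delOp_mul (b : ℕ → ℂ) (n i : ℕ) :
    delOp^[n + 1] (fun i => (i : ℂ) * b i) i =
      i * delOp^[n + 1] b i - (n + 1) * delOp^[n] b (i + 1) := by
  induction n generalizing i with
  | zero => simp [delOp]; ring
  | succ n ih =>
    rw [iter_delOp_succ, ih, ih, iter_delOp_succ b (n + 1) i, iter_delOp_succ b n (i + 1)]
    push_cast; ring

lemma iter_delOp_shift (b : ℕ → ℂ) (n i : ℕ) :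
    delOp^[n] (fun i => b (i + 1)) i = delOp^[n] b (i + 1) := by
  induction n generalizing i with
  | zero => rfl
  | succ n ih => rw [iter_delOp_succ, ih, ih, iter_delOp_succ b n (i + 1)]

lemma iter_delOp_neg (b : ℕ → ℂ) (n i : ℕ) :
    delOp^[n] (fun i => - b i) i = - delOp^[n] b i := by
  induction n generalizing i with
  | zero => rfl
  | succ n ih => rw [iter_delOp_succ, ih, ih, iter_delOp_succ b n i]; ring

lemma iter_delOp_add (a b : ℕ → ℂ) (n i : ℕ) :
    delOp^[n] (fun i => a i + b i) i = delOp^[n] a i + delOp^[n] b i := by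
  induction n generalizing i with
  | zero => rfl
  | succ n ih => rw [iter_delOp_succ, ih, ih, iter_delOp_succ b n i, iter_delOp_succ a n i]; ring

lemma nabla_div (a b : ℕ → ℂ) (h : ∀ n, a n = ((n : ℂ) + 1) * b n) (n : ℕ) :
    ((n : ℂ) + 1) * nablaOp b n = ∑ k ∈ Finset.range (n + 1), nablaOp a k := by
  have ha : a = fun i : ℕ => (i : ℂ) * b i + b i := by
    funext i; rw [h]; ring
  induction n with
  | zero => simp [nablaOp, h]
  | succ n ih =>
    rw [Finset.sum_range_succ, ← ih]
    have : nablaOp a (n + 1) = - (n + 1) * delOp^[n] b 1 + delOp^[n + 1] b 0 := by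
      unfold nablaOp
      rw [ha, iter_delOp_add, iter_delOp_mul]; simp; ring
    rw [this]
    have h2 := iter_delOp_succ b n 0
    simp only [nablaOp]
    simp only [zero_add] at h2
    rw [h2]
    push_cast; ring

lemma nabla_sum (a b : ℕ → ℂ) (h : ∀ n : ℕ, ((n : ℂ) + 1) * b n = ∑ k ∈ Finset.range (n + 1), a k)
    (n : ℕ) : nablaOp a n = ((n : ℂ) + 1) * nablaOp b n := by
  have he : delOp (fun i => (i : ℂ) * (fun i => b (i - 1)) i) = fun i => - a i := by
    funext i
    simp only [delOp]
    cases i with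
    | zero => have := h 0; simp at this; simp [this]
    | succ i =>
      have h1 := h i
      have h2 := h (i + 1)
      rw [Finset.sum_range_succ, ← h1] at h2
      push_cast at h2 ⊢
      linear_combination -h2
  have h3 := iter_delOp_mul (fun i => b (i - 1)) n 0
  rw [Function.iterate_succ_apply, he, iter_delOp_neg, ← iter_delOp_shift] at h3
  simp only [Nat.add_sub_cancel] at h3
  simp only [nablaOp]
  push_cast at h3
  linear_combination -h3

lemma nat_cast_add_one_ne (n : ℕ) : ((n : ℂ) + 1) ≠ 0 := by exact_mod_cast Nat.succ_ne_zero n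

lemma nabla_sWp (B B' : Finset ℕ) (m : ℕ) (h : ∀ i, 1 ≤ i → i ≤ m → (i ∈ B' ↔ i ∉ B)) :
    nablaOp (sWp B m) = sWp B' m := by
  induction m with
  | zero =>
    funext n
    have h1 := nabla_div (fun _ => 1) (sWp B 0) (fun n => by
      simp only [sWp]; field_simp [nat_cast_add_one_ne n]) n
    have h2 : ∀ k, nablaOp (fun _ => 1) (k + 1) = 0 := by
      intro k
      simp only [nablaOp]
      rw [Function.iterate_succ_apply]
      have : delOp (fun _ => (1 : ℂ)) = fun _ => 0 := by funext i; simp [delOp]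
      rw [this]
      have : ∀ i, delOp^[k] (fun _ => (0 : ℂ)) i = 0 := by
        intro i
        induction k generalizing i with
        | zero => rfl
        | succ k ih => rw [iter_delOp_succ, ih, ih]; simp
      exact this 0
    rw [Finset.sum_range_succ'] at h1
    simp only [h2] at h1
    change nablaOp (sWp B 0) n = 1 / ((n : ℂ) + 1)
    rw [eq_div_iff (nat_cast_add_one_ne n), mul_comm, h1]
    simp [nablaOp]
  | succ m ih =>
    have ih' := ih (fun i h1 h2 => h i h1 (by omega))
    have hm := h (m + 1) (by omega) le_rfl
    funext n
    by_cases hB : m + 1 ∈ B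
    · have hB' : m + 1 ∉ B' := by tauto
      have := nabla_sum (sWp B m) (sWp B (m + 1)) (fun n => by
        simp only [sWp, if_pos hB]; field_simp [nat_cast_add_one_ne n]) n
      rw [ih'] at this
      conv_rhs => simp only [sWp, if_neg hB']
      rw [this]; field_simp [nat_cast_add_one_ne n]
    · have hB' : m + 1 ∈ B' := by tauto
      have := nabla_div (sWp B m) (sWp B (m + 1)) (fun n => by
        simp only [sWp, if_neg hB]; field_simp [nat_cast_add_one_ne n]) n
      rw [ih'] at this
      conv_rhs => simp only [sWp, if_pos hB']
      rw [← this]; field_simp [nat_cast_add_one_ne n]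

end NewtonAux


section NewtonAnalysis

open Filter Asymptotics Topology

lemma cbinom_isBigO (z : ℂ) :
    (fun n : ℕ => cbinom z (n + 1)) =O[atTop] (fun n : ℕ => (n : ℝ) ^ (-z.re - 1)) := by
  by_cases hz : ∃ N : ℕ, z = N
  · obtain ⟨N, rfl⟩ := hz
    have : (fun n : ℕ => cbinom (N : ℂ) (n + 1)) =ᶠ[atTop] fun _ => (0 : ℂ) := by
      filter_upwards [eventually_ge_atTop N] with n hn
      unfold cbinom
      rw [Finset.prod_eq_zero (i := N) (by simp; omega) (by simp)]
      simp
    exact this.trans_isBigO (isBigO_zero _ _)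
  · push Not at hz
    have hG : Complex.Gamma (-z) ≠ 0 := Complex.Gamma_ne_zero (fun m h => hz m (by
      have := congrArg Neg.neg h; simpa using this))
    have ht := ((Complex.GammaSeq_tendsto_Gamma (-z)).inv₀ hG).norm
    refine IsBigO.of_bound (‖(Complex.Gamma (-z))⁻¹‖ + 1) ?_
    filter_upwards [eventually_ge_atTop 1, ht.eventually (gt_mem_nhds (lt_add_one _))] with n hn hb
    have hn0 : (0 : ℝ) < n := by exact_mod_cast hn
    have hprod : ∏ j ∈ Finset.range (n + 1), (-z + (j : ℂ)) =
        (-1) ^ (n + 1) * ∏ j ∈ Finset.range (n + 1), (z - (j : ℂ)) := by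
      rw [← Finset.card_range (n + 1), ← Finset.prod_const, Finset.card_range,
        ← Finset.prod_mul_distrib]
      refine Finset.prod_congr rfl fun j _ => ?_
      ring
    have key : ‖cbinom z (n + 1)‖ =
        ‖(Complex.GammaSeq (-z) n)⁻¹‖ * ((n : ℝ) ^ (-z.re) / ((n : ℝ) + 1)) := by
      unfold Complex.GammaSeq cbinom
      rw [hprod]
      have h1 : ‖(n : ℂ) ^ (-z)‖ = (n : ℝ) ^ (-z.re) := by
        rw [Complex.norm_natCast_cpow_of_pos (by omega)]; simp
      have h2 : (0 : ℝ) < (n : ℝ) ^ (-z.re) := Real.rpow_pos_of_pos hn0 _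
      have h3 : (0 : ℝ) < (n.factorial : ℝ) := by positivity
      rw [Nat.factorial_succ]
      simp only [norm_div, norm_mul, norm_pow, norm_neg, norm_one, one_pow, one_mul, h1,
        Nat.cast_mul, Complex.norm_natCast, inv_div]
      push_cast
      have h4 : (0 : ℝ) < (n : ℝ) + 1 := by positivity
      field_simp
    rw [key]
    have h2 : (0 : ℝ) < (n : ℝ) ^ (-z.re) := Real.rpow_pos_of_pos hn0 _
    have h6 : (n : ℝ) ^ (-z.re - 1) = (n : ℝ) ^ (-z.re) / n := by
      rw [Real.rpow_sub hn0, Real.rpow_one]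
    rw [Real.norm_of_nonneg (by positivity), h6]
    gcongr
    linarith

/-- The connector `n! k! / (n+k)!`. -/
noncomputable def Cc (n k : ℕ) : ℝ := (n.factorial : ℝ) * k.factorial / (n + k).factorial

lemma Cc_pos (n k : ℕ) : 0 < Cc n k := by unfold Cc; positivity

lemma Cc_zero (n : ℕ) : Cc n 0 = 1 := by
  unfold Cc; simp [Nat.factorial_ne_zero]

lemma Cc_succ (n k : ℕ) : Cc n (k + 1) * ((n : ℝ) + k + 1) = (k + 1) * Cc n k := by
  unfold Cc
  rw [← add_assoc, Nat.factorial_succ (n + k), Nat.factorial_succ k]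
  push_cast
  field_simp

lemma Cc_succ_left (n k : ℕ) : Cc (n + 1) k * ((n : ℝ) + k + 1) = (n + 1) * Cc n k := by
  unfold Cc
  rw [show n + 1 + k = (n + k) + 1 by ring, Nat.factorial_succ (n + k), Nat.factorial_succ n]
  push_cast
  field_simp

lemma Cc_antitone (n : ℕ) : Antitone (Cc n) := by
  refine antitone_nat_of_succ_le fun k => ?_
  have h1 := Cc_succ n k
  have h2 := Cc_pos n k
  have h3 : (0 : ℝ) < (n : ℝ) + k + 1 := by positivity
  have : Cc n (k + 1) = (k + 1) * Cc n k / ((n : ℝ) + k + 1) := by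
    rw [eq_div_iff h3.ne', h1]
  rw [this, div_le_iff₀ h3]
  have : (0 : ℝ) ≤ n := by positivity
  nlinarith [mul_nonneg h2.le this]

lemma Cc_tendsto (n : ℕ) : Tendsto (Cc (n + 1)) atTop (𝓝 0) := by
  have hle : ∀ k : ℕ, Cc (n + 1) k ≤ ((n : ℝ) + 1) * (1 / ((k : ℝ) + 1)) := by
    intro k
    have h1 := Cc_succ_left n k
    have h2 : Cc n k ≤ 1 := by
      rw [← Cc_zero n]; exact Cc_antitone n (Nat.zero_le k)
    have h3 := Cc_pos (n + 1) k
    have h4 : (0 : ℝ) ≤ n := by positivity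
    have h5 : (0 : ℝ) < (k : ℝ) + 1 := by positivity
    rw [mul_one_div, le_div_iff₀ h5]
    nlinarith [mul_nonneg h3.le h4, Cc_pos n k]
  refine squeeze_zero (fun k => (Cc_pos _ _).le) hle ?_
  have := (tendsto_one_div_add_atTop_nhds_zero_nat (𝕜 := ℝ)).const_mul ((n : ℝ) + 1)
  simpa using this

lemma Cc_isBigO (k : ℕ) :
    (fun n : ℕ => Cc (n + 1) k) =O[atTop] (fun n : ℕ => (n : ℝ) ^ (-(k : ℝ))) := by
  refine IsBigO.of_bound (k.factorial : ℝ) ?_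
  filter_upwards [eventually_ge_atTop 1] with n hn
  have hn0 : (0 : ℝ) < n := by exact_mod_cast hn
  rw [Real.norm_of_nonneg (Cc_pos _ _).le, Real.norm_of_nonneg (by positivity),
    Real.rpow_neg hn0.le, Real.rpow_natCast, ← div_eq_mul_inv]
  unfold Cc
  rw [← Nat.factorial_mul_ascFactorial (n + 1) k, Nat.cast_mul]
  have h1 : (n : ℝ) ^ k ≤ ((n + 1 + 1).ascFactorial k : ℝ) := by
    have h := Nat.pow_succ_le_ascFactorial (n + 1 + 1) k
    have h2 : n ^ k ≤ (n + 1 + 1) ^ k := Nat.pow_le_pow_left (by omega) k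
    exact_mod_cast h2.trans h
  have h0 : (0 : ℝ) < (n : ℝ) ^ k := by positivity
  have h3 : (0 : ℝ) < ((n + 1).factorial : ℝ) := by positivity
  rw [mul_div_mul_left _ _ h3.ne']
  gcongr

/-- Harmonic numbers. -/
noncomputable def Hr (n : ℕ) : ℝ := ∑ k ∈ Finset.range (n + 1), 1 / ((k : ℝ) + 1)

lemma one_le_Hr (n : ℕ) : 1 ≤ Hr n := by
  unfold Hr
  rw [Finset.sum_range_succ']
  have : 0 ≤ ∑ k ∈ Finset.range n, 1 / (((k + 1 : ℕ) : ℝ) + 1) :=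
    Finset.sum_nonneg fun _ _ => by positivity
  simp at this ⊢
  exact this

lemma Hr_mono : Monotone Hr := by
  refine monotone_nat_of_le_succ fun n => ?_
  unfold Hr
  rw [Finset.sum_range_succ _ (n + 1)]
  have : (0 : ℝ) ≤ 1 / (((n + 1 : ℕ) : ℝ) + 1) := by positivity
  linarith

lemma Hr_isBigO (ε : ℝ) (hε : 0 < ε) : Hr =O[atTop] (fun n : ℕ => (n : ℝ) ^ ε) := by
  refine IsBigO.of_bound (1 + 2 ^ ε / ε) ?_
  filter_upwards [eventually_ge_atTop 1] with n hn
  have hn1 : (1 : ℝ) ≤ n := by exact_mod_cast hn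
  have hn0 : (0 : ℝ) < n := by linarith
  rw [Real.norm_of_nonneg (by linarith [one_le_Hr n]), Real.norm_of_nonneg (by positivity)]
  have h1 := harmonic_le_one_add_log (n + 1)
  have h2 : ((harmonic (n + 1) : ℚ) : ℝ) = Hr n := by
    unfold Hr harmonic
    push_cast
    simp
  rw [h2] at h1
  have h3 := Real.log_le_rpow_div (x := ((n + 1 : ℕ) : ℝ)) (by positivity) hε
  have h4 : (((n + 1 : ℕ) : ℝ)) ^ ε ≤ 2 ^ ε * (n : ℝ) ^ ε := by
    rw [← Real.mul_rpow (by norm_num) hn0.le]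
    refine Real.rpow_le_rpow (by positivity) ?_ hε.le
    push_cast; linarith
  have h5 : (1 : ℝ) ≤ (n : ℝ) ^ ε := Real.one_le_rpow hn1 hε.le
  calc Hr n ≤ 1 + (((n + 1 : ℕ) : ℝ)) ^ ε / ε := by linarith
    _ ≤ (n : ℝ) ^ ε + (2 ^ ε * (n : ℝ) ^ ε) / ε := by gcongr
    _ = _ := by ring

/-- Growth of order `n^{-e}` up to arbitrarily small powers. -/
def Gr (s : ℕ → ℂ) (e : ℕ) : Prop :=
  ∀ ε : ℝ, 0 < ε → s =O[atTop] (fun n : ℕ => (n : ℝ) ^ (-(e : ℝ) + ε))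

lemma Gr_of_bound (s : ℕ → ℂ) (e m : ℕ) (h : ∀ n, ‖s n‖ ≤ Hr n ^ m / ((n : ℝ) + 1) ^ e) :
    Gr s e := by
  intro ε hε
  have h1 := (Hr_isBigO (ε / (m + 1)) (by positivity)).pow m
  have h2 : (fun n : ℕ => 1 / ((n : ℝ) + 1) ^ e) =O[atTop] (fun n : ℕ => (n : ℝ) ^ (-(e : ℝ))) := by
    refine IsBigO.of_bound 1 ?_
    filter_upwards [eventually_ge_atTop 1] with n hn
    have hn0 : (0 : ℝ) < n := by exact_mod_cast hn
    rw [Real.norm_of_nonneg (by positivity), Real.norm_of_nonneg (by positivity),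
      Real.rpow_neg hn0.le, Real.rpow_natCast, one_mul, ← one_div]
    gcongr
    linarith
  have h3 : s =O[atTop] fun n => Hr n ^ m * (1 / ((n : ℝ) + 1) ^ e) := by
    refine IsBigO.of_bound 1 (Eventually.of_forall fun n => ?_)
    have := h n
    have hp : (0 : ℝ) ≤ Hr n := by linarith [one_le_Hr n]
    rw [Real.norm_of_nonneg (by positivity), one_mul, mul_one_div]
    exact this
  refine (h3.trans (h1.mul h2)).trans ?_
  refine IsBigO.of_bound 1 ?_
  filter_upwards [eventually_ge_atTop 1] with n hn
  have hn1 : (1 : ℝ) ≤ n := by exact_mod_cast hn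
  have hn0 : (0 : ℝ) < n := by linarith
  rw [Real.norm_of_nonneg (by positivity), Real.norm_of_nonneg (by positivity), one_mul,
    ← Real.rpow_mul_natCast hn0.le, ← Real.rpow_add hn0]
  refine Real.rpow_le_rpow_of_exponent_le hn1 ?_
  have : ε / (m + 1) * m ≤ ε := by
    rw [div_mul_eq_mul_div, div_le_iff₀ (by positivity)]
    nlinarith
  linarith

/-- The leading exponent. -/
def eW (B : Finset ℕ) : ℕ → ℕ
  | 0 => 1
  | m + 1 => if m + 1 ∈ B then 1 else eW B m + 1

lemma one_le_eW (B : Finset ℕ) (m : ℕ) : 1 ≤ eW B m := by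
  cases m with
  | zero => simp [eW]
  | succ m => simp only [eW]; split_ifs <;> omega

lemma norm_cast_succ (n : ℕ) : ‖(n : ℂ) + 1‖ = (n : ℝ) + 1 := by
  have := Complex.norm_natCast (n + 1); push_cast at this; exact this

lemma sum_bound (s : ℕ → ℂ) (e m : ℕ) (he : 1 ≤ e)
    (h : ∀ n, ‖s n‖ ≤ Hr n ^ m / ((n : ℝ) + 1) ^ e) (n : ℕ) :
    ‖∑ k ∈ Finset.range (n + 1), s k‖ ≤ Hr n ^ (m + 1) := by
  refine (norm_sum_le _ _).trans ?_
  calc ∑ k ∈ Finset.range (n + 1), ‖s k‖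
      ≤ ∑ k ∈ Finset.range (n + 1), Hr n ^ m * (1 / ((k : ℝ) + 1)) := by
        refine Finset.sum_le_sum fun k hk => (h k).trans ?_
        have hk' : k ≤ n := by simp at hk; omega
        have h0 : (0 : ℝ) ≤ Hr k := by linarith [one_le_Hr k]
        have h00 : (0 : ℝ) ≤ Hr n := by linarith [one_le_Hr n]
        rw [mul_one_div]
        have h1 : (1 : ℝ) ≤ (k : ℝ) + 1 := by linarith [(Nat.cast_nonneg k : (0 : ℝ) ≤ k)]
        have h2 : ((k : ℝ) + 1) ≤ ((k : ℝ) + 1) ^ e := le_self_pow₀ h1 (by omega)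
        have h3 := Hr_mono hk'
        gcongr
    _ = Hr n ^ (m + 1) := by
        rw [← Finset.mul_sum, pow_succ]; rfl

lemma sWp_bound (B : Finset ℕ) (m n : ℕ) :
    ‖sWp B m n‖ ≤ Hr n ^ m / ((n : ℝ) + 1) ^ (eW B m) := by
  induction m generalizing n with
  | zero => simp [sWp, eW, norm_cast_succ]
  | succ m ih =>
    have h0 : (0 : ℝ) ≤ Hr n := by linarith [one_le_Hr n]
    simp only [sWp, eW]
    split_ifs with hB
    · have := sum_bound (sWp B m) _ m (one_le_eW B m) ih n
      rw [norm_mul, norm_div, norm_one, norm_cast_succ, pow_one, one_div_mul_eq_div]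
      gcongr
    · rw [norm_mul, norm_div, norm_one, norm_cast_succ, one_div_mul_eq_div]
      rw [pow_succ ((n : ℝ) + 1), ← div_div]
      have : Hr n ^ m ≤ Hr n ^ (m + 1) := pow_le_pow_right₀ (one_le_Hr n) (by omega)
      have h2 := ih n
      refine div_le_div_of_nonneg_right (h2.trans ?_) (by positivity)
      gcongr

/-- The connected weight. -/
noncomputable def gK (z : ℂ) (k n : ℕ) : ℂ := (-1) ^ n * cbinom z (n + 1) * (Cc (n + 1) k : ℂ)

lemma gK_isBigO (z : ℂ) (k : ℕ) :
    (fun n => gK z k n) =O[atTop] (fun n : ℕ => (n : ℝ) ^ (-z.re - 1 - k)) := by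
  have h1 := (cbinom_isBigO z).norm_left.mul (Cc_isBigO k)
  have h2 : (fun n => gK z k n) =O[atTop] fun n : ℕ => ‖cbinom z (n + 1)‖ * Cc (n + 1) k := by
    refine IsBigO.of_bound 1 (Eventually.of_forall fun n => ?_)
    unfold gK
    have := Cc_pos (n + 1) k
    simp [abs_of_pos this]
  refine (h2.trans h1).trans_eventuallyEq ?_
  filter_upwards [eventually_ge_atTop 1] with n hn
  have hn0 : (0 : ℝ) < n := by exact_mod_cast hn
  rw [← Real.rpow_add hn0, ← sub_eq_add_neg]

lemma gK_mul_isBigO (z : ℂ) (k e : ℕ) (s : ℕ → ℂ) (hs : Gr s e) (ε : ℝ) (hε : 0 < ε) :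
    (fun n => gK z k n * s n) =O[atTop] (fun n : ℕ => (n : ℝ) ^ (-(z.re + 1 + k + e) + ε)) := by
  refine ((gK_isBigO z k).mul (hs ε hε)).trans_eventuallyEq ?_
  filter_upwards [eventually_ge_atTop 1] with n hn
  have hn0 : (0 : ℝ) < n := by exact_mod_cast hn
  rw [← Real.rpow_add hn0]
  congr 1; ring

lemma gK_summable (z : ℂ) (k e : ℕ) (s : ℕ → ℂ) (hs : Gr s e) (h : 0 < z.re + k + e) :
    Summable (fun n => gK z k n * s n) := by
  refine summable_of_isBigO_nat ?_
    (gK_mul_isBigO z k e s hs ((z.re + k + e) / 2) (by positivity))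
  rw [Real.summable_nat_rpow]
  linarith

/-- The connected sum. -/
noncomputable def Vs (z : ℂ) (s : ℕ → ℂ) (k : ℕ) : ℂ := ∑' n, gK z k n * s n

lemma Vs_step (z : ℂ) (s X : ℕ → ℂ) (k e : ℕ) (hX : ∀ n : ℕ, ((n : ℂ) + 1) * s n = X n) (hs : Gr s e)
    (h : 0 < z.re + k + e) :
    Vs z s k - Vs z s (k + 1) = 1 / ((k : ℂ) + 1) * Vs z X (k + 1) := by
  unfold Vs
  rw [← (gK_summable z k e s hs h).tsum_sub
    (gK_summable z (k + 1) e s hs (by push_cast; linarith)), ← tsum_mul_left]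
  refine tsum_congr fun n => ?_
  rw [← hX]
  unfold gK
  have h1 := Cc_succ (n + 1) k
  have h2 : ((Cc (n + 1) (k + 1) : ℝ) : ℂ) * ((n : ℂ) + 1 + k + 1) = (k + 1) * (Cc (n + 1) k : ℂ) := by
    exact_mod_cast h1
  have h3 := nat_cast_add_one_ne k
  field_simp
  linear_combination (-1) * cbinom z (n + 1) * s n * h2

lemma Vs_tendsto (z : ℂ) (s : ℕ → ℂ) (k e : ℕ) (hs : Gr s e) (h : 0 < z.re + k + e) :
    Tendsto (fun k => Vs z s k) atTop (𝓝 0) := by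
  have := tendsto_tsum_of_dominated_convergence (f := fun k n => gK z k n * s n)
    (g := fun _ => (0 : ℂ)) (𝓕 := atTop) (gK_summable z k e s hs h).norm ?_ ?_
  · simpa [Vs] using this
  · intro n
    have h1 := ((Complex.continuous_ofReal.tendsto 0).comp (Cc_tendsto n)).const_mul
      ((-1) ^ n * cbinom z (n + 1))
    have h2 := h1.mul_const (s n)
    simpa [gK] using h2
  · filter_upwards [eventually_ge_atTop k] with j hj n
    unfold gK
    have h1 := Cc_antitone (n + 1) hj
    have h2 := Cc_pos (n + 1) j
    have h3 := Cc_pos (n + 1) k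
    simp only [norm_mul, Complex.norm_real, Real.norm_of_nonneg h2.le, Real.norm_of_nonneg h3.le]
    gcongr

lemma cbinom_succ (z : ℂ) (n : ℕ) : cbinom z (n + 1) * ((n : ℂ) + 1) = cbinom z n * (z - n) := by
  unfold cbinom
  rw [Finset.prod_range_succ, Nat.factorial_succ]
  have := nat_cast_add_one_ne n
  have : (n.factorial : ℂ) ≠ 0 := by exact_mod_cast n.factorial_ne_zero
  push_cast
  field_simp

lemma gK_succ (z : ℂ) (k n : ℕ) :
    gK z k (n + 1) * ((n : ℂ) + k + 2) = - gK z k n * (z - (n + 1)) := by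
  have h1 := cbinom_succ z (n + 1)
  have h2 : ((Cc (n + 1 + 1) k : ℝ) : ℂ) * ((n : ℂ) + 1 + k + 1) = (n + 1 + 1) * (Cc (n + 1) k : ℂ) := by
    exact_mod_cast Cc_succ_left (n + 1) k
  unfold gK
  push_cast at h1
  rw [pow_succ]
  linear_combination (-1) * (-1) ^ n * cbinom z (n + 1 + 1) * h2
    - (-1) ^ n * (Cc (n + 1) k : ℂ) * h1

lemma Vs_sum (z : ℂ) (s : ℕ → ℂ) (k e : ℕ) (hs : Gr s e)
    (hS : Gr (fun n => ∑ i ∈ Finset.range (n + 1), s i) 0) (h1 : 0 < z.re + k + 1) (h : 0 < z.re + k + e) :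
    Vs z (fun n => ∑ i ∈ Finset.range (n + 1), s i) (k + 1) =
      ((k : ℂ) + 1) / (z + k + 1) * Vs z s k := by
  have hz : z + k + 1 ≠ 0 := by
    intro h0
    have := congrArg Complex.re h0
    simp at this
    linarith
  set S : ℕ → ℂ := fun n => ∑ i ∈ Finset.range (n + 1), s i with hSdef
  set hh : ℕ → ℂ := fun n => gK z (k + 1) n * ((n : ℂ) + k + 2) / (z + k + 1) with hhdef
  have hdiff : ∀ n, gK z (k + 1) n = hh n - hh (n + 1) := by
    intro n
    have := gK_succ z (k + 1) n
    simp only [hhdef]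
    push_cast at this ⊢
    field_simp
    linear_combination this
  have hhs : ∀ n, hh n * s n = ((k : ℂ) + 1) / (z + k + 1) * (gK z k n * s n) := by
    intro n
    have h2 : ((Cc (n + 1) (k + 1) : ℝ) : ℂ) * ((n : ℂ) + 1 + k + 1) =
        (k + 1) * (Cc (n + 1) k : ℂ) := by exact_mod_cast Cc_succ (n + 1) k
    simp only [hhdef, gK]
    field_simp
    linear_combination cbinom z (n + 1) * s n * h2
  have hsumS : Summable (fun n => gK z (k + 1) n * S n) :=
    gK_summable z (k + 1) 0 S hS (by push_cast; linarith)
  have hsums := (gK_summable z k e s hs h)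
  have hpart : ∀ M, ∑ n ∈ Finset.range M, gK z (k + 1) n * S n =
      ∑ n ∈ Finset.range M, hh n * s n - hh M * ∑ i ∈ Finset.range M, s i := by
    intro M
    induction M with
    | zero => simp
    | succ M ih =>
      rw [Finset.sum_range_succ, ih, hdiff, Finset.sum_range_succ _ M]
      simp only [hSdef]
      rw [Finset.sum_range_succ s M]
      ring
  have hlim0 : Tendsto (fun n => hh n * S n) atTop (𝓝 0) := by
    have hO := gK_mul_isBigO z (k + 1) 0 S hS ((z.re + k + 1) / 2) (by positivity)
    have hO2 : (fun n : ℕ => ((n : ℂ) + k + 2) / (z + k + 1)) =O[atTop] fun n : ℕ => (n : ℝ) := by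
      refine IsBigO.of_bound ((k + 3) / ‖z + k + 1‖) ?_
      filter_upwards [eventually_ge_atTop 1] with n hn
      have hn1 : (1 : ℝ) ≤ n := by exact_mod_cast hn
      have : ‖(n : ℂ) + k + 2‖ = (n : ℝ) + k + 2 := by
        have := Complex.norm_natCast (n + k + 2); push_cast at this; exact this
      rw [norm_div, this, Real.norm_of_nonneg (by linarith), div_mul_eq_mul_div]
      have hk : (0 : ℝ) ≤ k := by positivity
      gcongr
      nlinarith
    have hO3 := (hO.mul hO2).trans_eventuallyEq
      (g₂ := fun n : ℕ => (n : ℝ) ^ (-((z.re + k + 1) / 2))) (by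
        filter_upwards [eventually_ge_atTop 1] with n hn
        have hn0 : (0 : ℝ) < n := by exact_mod_cast hn
        nth_rewrite 2 [← Real.rpow_one (n : ℝ)]
        rw [← Real.rpow_add hn0]
        congr 1; push_cast; ring)
    have ht : Tendsto (fun n : ℕ => (n : ℝ) ^ (-((z.re + k + 1) / 2))) atTop (𝓝 0) :=
      (tendsto_rpow_neg_atTop (by positivity)).comp tendsto_natCast_atTop_atTop
    refine (hO3.trans_tendsto ht).congr fun n => ?_
    simp only [hhdef]; ring
  have hlim1 : Tendsto (fun M => hh M * ∑ i ∈ Finset.range M, s i) atTop (𝓝 0) := by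
    rw [← tendsto_add_atTop_iff_nat 1]
    have := hlim0.sub hsumS.tendsto_atTop_zero
    rw [sub_zero] at this
    refine this.congr fun n => ?_
    rw [hdiff]; simp only [hSdef]; ring
  have hA := hsumS.hasSum.tendsto_sum_nat
  have hB : Tendsto (fun M => ∑ n ∈ Finset.range M, hh n * s n) atTop
      (𝓝 (((k : ℂ) + 1) / (z + k + 1) * Vs z s k)) := by
    simp only [hhs]
    exact (hsums.hasSum.mul_left _).tendsto_sum_nat
  have hC := hB.sub hlim1
  rw [sub_zero] at hC
  exact tendsto_nhds_unique hA (hC.congr fun M => (hpart M).symm)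

lemma Gr_sWp (B : Finset ℕ) (m : ℕ) : Gr (sWp B m) (eW B m) :=
  Gr_of_bound _ _ m (sWp_bound B m)

lemma Gr_sum (s : ℕ → ℂ) (e m : ℕ) (he : 1 ≤ e)
    (h : ∀ n, ‖s n‖ ≤ Hr n ^ m / ((n : ℝ) + 1) ^ e) :
    Gr (fun n => ∑ i ∈ Finset.range (n + 1), s i) 0 :=
  Gr_of_bound _ 0 (m + 1) fun n => by
    simpa using sum_bound s e m he h n

lemma W_zero_step (B : Finset ℕ) (z : ℂ) (j : ℕ) (h : 0 < z.re + j + 1) :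
    Vs z (sWp B 0) j - Vs z (sWp B 0) (j + 1) = 1 / ((j : ℂ) + 1) - 1 / ((j : ℂ) + 1 + z) := by
  have hz : z + j + 1 ≠ 0 := by
    intro h0
    have := congrArg Complex.re h0
    simp at this
    linarith
  have hz' : (j : ℂ) + 1 + z ≠ 0 := by convert hz using 1; ring
  set d : ℕ → ℂ := fun n => if n = 0 then 1 else 0 with hd
  have hdb : ∀ n, ‖d n‖ ≤ Hr n ^ 0 / ((n : ℝ) + 1) ^ 1 := by
    intro n
    simp only [hd]
    split_ifs with h0
    · subst h0; simp
    · simp; positivity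
  have hdsum : ∀ n, ∑ i ∈ Finset.range (n + 1), d i = 1 := by
    intro n; simp [hd]
  rw [Vs_step z (sWp B 0) (fun n => ∑ i ∈ Finset.range (n + 1), d i) j 1 (fun n => by
    rw [hdsum]; simp only [sWp]; field_simp [nat_cast_add_one_ne n]) (Gr_sWp B 0) (by simpa using h),
    Vs_sum z d j 1 (Gr_of_bound d 1 0 hdb) (Gr_sum d 1 0 le_rfl hdb) h (by simpa using h)]
  have : Vs z d j = z / (j + 1) := by
    unfold Vs
    rw [tsum_eq_single 0 (by intro b hb; simp [hd, hb])]
    have h2 : ((Cc (0 + 1) j : ℝ) : ℂ) * (((0 : ℕ) : ℂ) + j + 1) = (((0 : ℕ) : ℂ) + 1) * (Cc 0 j : ℂ) := by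
      exact_mod_cast Cc_succ_left 0 j
    have h3 : Cc 0 j = 1 := by unfold Cc; simp [Nat.factorial_ne_zero]
    rw [h3] at h2
    have := nat_cast_add_one_ne j
    simp only [gK, cbinom, hd]
    simp at h2 ⊢
    field_simp
    linear_combination z * h2
  rw [this]
  have := nat_cast_add_one_ne j
  field_simp
  ring

lemma W_true_step (B : Finset ℕ) (m : ℕ) (hB : m + 1 ∈ B) (z : ℂ) (j : ℕ) (h : 0 < z.re + j + 1) :
    Vs z (sWp B (m + 1)) j - Vs z (sWp B (m + 1)) (j + 1) =
      1 / ((j : ℂ) + 1 + z) * Vs z (sWp B m) j := by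
  have hz : z + j + 1 ≠ 0 := by
    intro h0
    have := congrArg Complex.re h0
    simp at this
    linarith
  have hz' : (j : ℂ) + 1 + z ≠ 0 := by convert hz using 1; ring
  have he : (1 : ℝ) ≤ eW B m := by exact_mod_cast one_le_eW B m
  rw [Vs_step z (sWp B (m + 1)) (fun n => ∑ i ∈ Finset.range (n + 1), sWp B m i) j _ (fun n => by
    simp only [sWp, if_pos hB]; field_simp [nat_cast_add_one_ne n]) (Gr_sWp B (m + 1))
    (by simpa [eW, hB] using h),
    Vs_sum z (sWp B m) j _ (Gr_sWp B m) (Gr_sum _ _ m (one_le_eW B m) (sWp_bound B m)) h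
      (by linarith)]
  have := nat_cast_add_one_ne j
  field_simp
  ring

lemma W_false_step (B : Finset ℕ) (m : ℕ) (hB : m + 1 ∉ B) (z : ℂ) (j : ℕ)
    (h : 0 < z.re + j + eW B (m + 1)) :
    Vs z (sWp B (m + 1)) j - Vs z (sWp B (m + 1)) (j + 1) =
      1 / ((j : ℂ) + 1) * Vs z (sWp B m) (j + 1) :=
  Vs_step z (sWp B (m + 1)) (sWp B m) j _ (fun n => by
    simp only [sWp, if_neg hB]; field_simp [nat_cast_add_one_ne n]) (Gr_sWp B (m + 1)) h

end NewtonAnalysis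


section NewtonMulti

open Filter Topology

/-- The recursive form of the summand of the multiple series. -/
noncomputable def Tm (B : Finset ℕ) (z : ℂ) : (m : ℕ) → ℕ → (Fin (m + 1) → ℕ) → ℂ
  | 0, j, v => if j < v 0 then 1 / (v 0 : ℂ) - 1 / ((v 0 : ℂ) + z) else 0
  | m + 1, j, v => if j < v (Fin.last (m + 1)) then
      (if m + 1 ∈ B then 1 / ((v (Fin.last (m + 1)) : ℂ) + z) *
          Tm B z m (v (Fin.last (m + 1)) - 1) (Fin.init v)
        else 1 / (v (Fin.last (m + 1)) : ℂ) * Tm B z m (v (Fin.last (m + 1))) (Fin.init v))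
      else 0

lemma finInit_eq {n : ℕ} (v : Fin (n + 1) → ℕ) (i : Fin n) : Fin.init v i = v i.castSucc := rfl

lemma tele (W f : ℕ → ℂ) (j : ℕ) (a : ℂ) (hf : HasSum f a) (h0 : ∀ k, k ≤ j → f k = 0)
    (h1 : ∀ k, j ≤ k → f (k + 1) = W k - W (k + 1)) (hW : Tendsto W atTop (𝓝 0)) : a = W j := by
  have hp : ∀ M, ∑ k ∈ Finset.range (M + (j + 1)), f k = W j - W (M + j) := by
    intro M
    induction M with
    | zero =>
      rw [Finset.sum_eq_zero (fun k hk => h0 k (by simp at hk; omega))]; simp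
    | succ M ih =>
      rw [show M + 1 + (j + 1) = M + (j + 1) + 1 by ring, Finset.sum_range_succ, ih,
        show M + (j + 1) = M + j + 1 by ring, h1 _ (by omega),
        show M + 1 + j = M + j + 1 by ring]
      ring
  have h2 := (tendsto_add_atTop_iff_nat (j + 1)).2 hf.tendsto_sum_nat
  have h3 := ((tendsto_add_atTop_iff_nat j).2 hW).const_sub (W j)
  rw [sub_zero] at h3
  exact tendsto_nhds_unique h2 (h3.congr fun M => (hp M).symm)

lemma summable_pi_prod (f : ℕ → ℝ) (hf0 : ∀ n, 0 ≤ f n) (hf : Summable f) (n : ℕ) :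
    Summable (fun v : Fin n → ℕ => ∏ i, f (v i)) := by
  induction n with
  | zero => exact (hasSum_fintype _).summable
  | succ n ih =>
    rw [← (Fin.snocEquiv (fun _ : Fin (n + 1) => ℕ)).summable_iff]
    have := hf.mul_of_nonneg ih hf0 (fun v => Finset.prod_nonneg fun i _ => hf0 _)
    refine this.congr fun x => ?_
    simp [Fin.prod_univ_castSucc, Fin.snocEquiv, mul_comm]

lemma Tm_ne_zero (B : Finset ℕ) (z : ℂ) (m j : ℕ) (v : Fin (m + 1) → ℕ) (h : Tm B z m j v ≠ 0) :
    ∀ i, j < v i ∧ v i ≤ v 0 := by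
  induction m generalizing j with
  | zero =>
    intro i
    have hi : i = 0 := Fin.ext (by simp)
    subst hi
    simp only [Tm] at h
    split_ifs at h with h1
    · exact ⟨h1, le_rfl⟩
    · exact absurd rfl h
  | succ m ih =>
    simp only [Tm] at h
    split_ifs at h with h1 h2
    · have h3 := ih _ _ (right_ne_zero_of_mul h)
      intro i
      refine Fin.lastCases ?_ (fun i => ?_) i
      · have := (h3 0).1
        simp only [finInit_eq, Fin.castSucc_zero] at this
        exact ⟨h1, by omega⟩
      · have := h3 i
        simp only [finInit_eq, Fin.castSucc_zero] at this
        exact ⟨by omega, this.2⟩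
    · have h3 := ih _ _ (right_ne_zero_of_mul h)
      intro i
      refine Fin.lastCases ?_ (fun i => ?_) i
      · have := (h3 0).1
        simp only [finInit_eq, Fin.castSucc_zero] at this
        exact ⟨h1, by omega⟩
      · have := h3 i
        simp only [finInit_eq, Fin.castSucc_zero] at this
        exact ⟨by omega, this.2⟩
    · exact absurd rfl h

lemma inv_bound (z : ℂ) (δ : ℝ) (hδ : 0 < δ) (k : ℕ) (hk : 0 < k) (h : δ ≤ z.re + k) :
    ‖1 / ((k : ℂ) + z)‖ ≤ (1 + |z.re| / δ) * (1 / (k : ℝ)) ∧ (k : ℂ) + z ≠ 0 := by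
  have hk0 : (0 : ℝ) < k := by exact_mod_cast hk
  have h1 : z.re + k ≤ ‖(k : ℂ) + z‖ := by
    refine le_trans ?_ (Complex.re_le_norm _)
    simp; linarith
  have h2 : 0 < ‖(k : ℂ) + z‖ := by linarith
  refine ⟨?_, norm_pos_iff.1 h2⟩
  rw [norm_div, norm_one, mul_one_div, div_le_div_iff₀ h2 hk0, one_mul]
  have h3 : |z.re| ≤ |z.re| / δ * ‖(k : ℂ) + z‖ := by
    rw [div_mul_eq_mul_div, le_div_iff₀ hδ]
    exact mul_le_mul_of_nonneg_left (by linarith) (abs_nonneg _)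
  have h4 := neg_abs_le z.re
  nlinarith

lemma Tm_bound (B : Finset ℕ) (z : ℂ) (δ : ℝ) (hδ : 0 < δ) (m j : ℕ) (v : Fin (m + 1) → ℕ)
    (h : δ ≤ z.re + j + eW B m) :
    ‖Tm B z m j v‖ ≤ (‖z‖ * (1 + |z.re| / δ) ^ (m + 1)) * ((1 / (v 0 : ℝ)) * ∏ i, 1 / (v i : ℝ)) := by
  have hc : 1 ≤ 1 + |z.re| / δ := by
    have : 0 ≤ |z.re| / δ := by positivity
    linarith
  induction m generalizing j with
  | zero =>
    simp only [Tm]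
    split_ifs with h1
    · have h1' : (j : ℝ) + 1 ≤ v 0 := by exact_mod_cast h1
      simp only [eW] at h
      push_cast at h
      obtain ⟨h2, h3⟩ := inv_bound z δ hδ (v 0) (by omega) (by linarith)
      have h4 : (v 0 : ℂ) ≠ 0 := by
        have : v 0 ≠ 0 := by omega
        exact_mod_cast this
      have h5 : 1 / (v 0 : ℂ) - 1 / ((v 0 : ℂ) + z) = z * (1 / (v 0 : ℂ)) * (1 / ((v 0 : ℂ) + z)) := by
        field_simp
        ring
      rw [h5, norm_mul, norm_mul, norm_div, norm_one, Complex.norm_natCast]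
      simp only [Fin.prod_univ_succ, Finset.univ_eq_empty, Finset.prod_empty, mul_one, zero_add, pow_one]
      calc _ ≤ ‖z‖ * (1 / (v 0 : ℝ)) * ((1 + |z.re| / δ) * (1 / (v 0 : ℝ))) := by gcongr
        _ = _ := by simp; ring
    · rw [norm_zero]; positivity
  | succ m ih =>
    rw [Fin.prod_univ_castSucc]
    have hv0 : v 0 = Fin.init v 0 := rfl
    have hvc : ∀ i : Fin (m + 1), v i.castSucc = Fin.init v i := fun i => rfl
    simp only [hv0, hvc]
    set k := v (Fin.last (m + 1)) with hk
    set w : Fin (m + 1) → ℕ := Fin.init v with hw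
    simp only [Tm]
    rw [← hk, ← hw]
    simp only [eW] at h
    set P : ℝ := (1 / (w 0 : ℝ)) * ∏ i, 1 / (w i : ℝ) with hP
    have hP0 : 0 ≤ P := by positivity
    have hrhs : (‖z‖ * (1 + |z.re| / δ) ^ (m + 1 + 1)) *
        ((1 / (w 0 : ℝ)) * ((∏ i, 1 / (w i : ℝ)) * (1 / (k : ℝ)))) =
        ((1 + |z.re| / δ) * (1 / (k : ℝ))) * ((‖z‖ * (1 + |z.re| / δ) ^ (m + 1)) * P) := by
      rw [hP]; ring
    rw [hrhs]
    split_ifs with h1 h2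
    · rw [if_pos h2] at h
      have h1' : (j : ℝ) + 1 ≤ k := by exact_mod_cast h1
      push_cast at h
      obtain ⟨h3, -⟩ := inv_bound z δ hδ k (by omega) (by linarith)
      have he : (1 : ℝ) ≤ eW B m := by exact_mod_cast one_le_eW B m
      have h4 := ih (k - 1) w (by
        have : ((k - 1 : ℕ) : ℝ) = k - 1 := by rw [Nat.cast_sub (by omega)]; simp
        rw [this]; linarith)
      rw [norm_mul]
      gcongr
    · rw [if_neg h2] at h
      have h1' : (j : ℝ) + 1 ≤ k := by exact_mod_cast h1
      push_cast at h
      have h4 := ih k w (by linarith)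
      rw [norm_mul, norm_div, norm_one, Complex.norm_natCast]
      have h5 : 1 / (k : ℝ) ≤ (1 + |z.re| / δ) * (1 / (k : ℝ)) :=
        le_mul_of_one_le_left (by positivity) hc
      gcongr
    · rw [norm_zero]; positivity

lemma Tm_summable (B : Finset ℕ) (z : ℂ) (m j : ℕ) (h : 0 < z.re + j + eW B m) :
    Summable (Tm B z m j) := by
  set K : ℝ := ‖z‖ * (1 + |z.re| / (z.re + j + eW B m)) ^ (m + 1) with hK
  have hK0 : 0 ≤ K := by positivity
  have hs : Summable (fun n : ℕ => (n : ℝ) ^ (-(1 + 1 / ((m : ℝ) + 1)))) := by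
    rw [Real.summable_nat_rpow]
    have : (0 : ℝ) < 1 / ((m : ℝ) + 1) := by positivity
    linarith
  have hs2 := (summable_pi_prod _ (fun n => by positivity) hs (m + 1)).mul_left K
  refine Summable.of_norm_bounded hs2 fun v => ?_
  by_cases h0 : Tm B z m j v = 0
  · rw [h0, norm_zero]; positivity
  · have h1 := Tm_ne_zero B z m j v h0
    refine (Tm_bound B z _ h m j v le_rfl).trans ?_
    refine mul_le_mul_of_nonneg_left ?_ hK0
    have hpos : ∀ i, (0 : ℝ) < v i := fun i => by
      have := (h1 i).1
      have : 0 < v i := by omega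
      exact_mod_cast this
    have h2 : 1 / (v 0 : ℝ) ≤ ∏ i, (v i : ℝ) ^ (-(1 / ((m : ℝ) + 1))) := by
      calc 1 / (v 0 : ℝ) = ∏ i : Fin (m + 1), (v 0 : ℝ) ^ (-(1 / ((m : ℝ) + 1))) := by
            rw [Finset.prod_const, Finset.card_univ, Fintype.card_fin,
              ← Real.rpow_mul_natCast (hpos 0).le]
            have : -(1 / ((m : ℝ) + 1)) * ((m + 1 : ℕ) : ℝ) = -1 := by
              push_cast; field_simp
            rw [this, Real.rpow_neg_one, one_div]
        _ ≤ _ := by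
            refine Finset.prod_le_prod (fun i _ => by positivity) fun i _ => ?_
            refine Real.rpow_le_rpow_of_nonpos (hpos i) (by exact_mod_cast (h1 i).2) ?_
            have : (0 : ℝ) < 1 / ((m : ℝ) + 1) := by positivity
            linarith
    calc (1 / (v 0 : ℝ)) * ∏ i, 1 / (v i : ℝ)
        ≤ (∏ i, (v i : ℝ) ^ (-(1 / ((m : ℝ) + 1)))) * ∏ i, 1 / (v i : ℝ) := by gcongr
      _ = _ := by
        rw [← Finset.prod_mul_distrib]
        refine Finset.prod_congr rfl fun i _ => ?_
        rw [neg_add, Real.rpow_add (hpos i), Real.rpow_neg_one, mul_comm, one_div]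

theorem hasSum_Tm (B : Finset ℕ) (z : ℂ) (m j : ℕ) (h : 0 < z.re + j + eW B m) :
    HasSum (Tm B z m j) (Vs z (sWp B m) j) := by
  have hsum := (Tm_summable B z m j h).hasSum
  have hlim := Vs_tendsto z (sWp B m) j _ (Gr_sWp B m) h
  convert hsum using 1
  symm
  induction m generalizing j with
  | zero =>
    rw [← (Equiv.funUnique (Fin 1) ℕ).symm.hasSum_iff] at hsum
    refine tele _ _ j _ hsum ?_ ?_ hlim
    · intro k hk
      simp [Tm, Equiv.funUnique, not_lt.2 hk]
    · intro k hk
      simp only [eW] at h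
      have hk' : (j : ℝ) ≤ k := by exact_mod_cast hk
      rw [W_zero_step B z k (by push_cast at h; linarith)]
      simp [Tm, Equiv.funUnique, Nat.lt_succ_of_le hk]
  | succ m ih =>
    have ih' : ∀ k : ℕ, 0 < z.re + k + eW B m → HasSum (Tm B z m k) (Vs z (sWp B m) k) := by
      intro k hk
      have h1 := (Tm_summable B z m k hk).hasSum
      rwa [ih k hk h1 (Vs_tendsto z (sWp B m) k _ (Gr_sWp B m) hk)] at h1
    rw [← (Fin.snocEquiv (fun _ : Fin (m + 2) => ℕ)).hasSum_iff] at hsum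
    have he : (1 : ℝ) ≤ eW B m := by exact_mod_cast one_le_eW B m
    have h' := h
    simp only [eW] at h'
    have hfib := HasSum.prod_fiberwise (g := fun k : ℕ => if j < k then
        (if m + 1 ∈ B then 1 / ((k : ℂ) + z) * Vs z (sWp B m) (k - 1)
          else 1 / (k : ℂ) * Vs z (sWp B m) k) else 0) hsum (by
      intro k
      simp only [Function.comp_def, Fin.snocEquiv, Equiv.coe_fn_mk, Tm, Fin.snoc_last, Fin.init_snoc]
      split_ifs with h1 h2
      · rw [if_pos h2] at h'
        refine (ih' (k - 1) ?_).mul_left _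
        have h1' : (j : ℝ) + 1 ≤ k := by exact_mod_cast h1
        have : ((k - 1 : ℕ) : ℝ) = k - 1 := by rw [Nat.cast_sub (by omega)]; simp
        push_cast at h'
        rw [this]; linarith
      · rw [if_neg h2] at h'
        refine (ih' k ?_).mul_left _
        have h1' : (j : ℝ) + 1 ≤ k := by exact_mod_cast h1
        push_cast at h'
        linarith
      · exact hasSum_zero)
    refine tele _ _ j _ hfib ?_ ?_ hlim
    · intro k hk
      simp [not_lt.2 hk]
    · intro k hk
      have hk' : (j : ℝ) ≤ k := by exact_mod_cast hk
      rw [if_pos (by omega)]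
      by_cases h2 : m + 1 ∈ B
      · rw [if_pos h2] at h' ⊢
        rw [W_true_step B m h2 z k (by push_cast at h'; linarith)]
        push_cast; simp
      · rw [if_neg h2]
        rw [W_false_step B m h2 z k (by linarith)]
        push_cast; simp

open Classical in
lemma Tm_eq (B : Finset ℕ) (z : ℂ) (m j : ℕ) (v : Fin (m + 1) → ℕ) :
    Tm B z m j v =
    if (∀ i, j < v i) ∧ (∀ i k : Fin (m + 1), (k : ℕ) = (i : ℕ) + 1 →
        (if (k : ℕ) ∈ B then v k ≤ v i else v k < v i))
    then ∏ i : Fin (m + 1), (if (i : ℕ) = 0 then (1 / (v i : ℂ) - 1 / ((v i : ℂ) + z))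
             else if (i : ℕ) ∈ B then 1 / ((v i : ℂ) + z)
             else 1 / (v i : ℂ))
    else 0 := by
  induction m generalizing j with
  | zero =>
    have : ∀ i : Fin 1, i = 0 := fun i => Subsingleton.elim i 0
    simp only [Tm]
    congr 1
    · simp
    · simp
  | succ m ih =>
    have hlast : (∀ i k : Fin (m + 1 + 1), (k : ℕ) = (i : ℕ) + 1 →
        (if (k : ℕ) ∈ B then v k ≤ v i else v k < v i)) ↔
        ((if m + 1 ∈ B then v (Fin.last (m + 1)) ≤ Fin.init v (Fin.last m)
            else v (Fin.last (m + 1)) < Fin.init v (Fin.last m)) ∧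
          (∀ i k : Fin (m + 1), (k : ℕ) = (i : ℕ) + 1 →
        (if (k : ℕ) ∈ B then Fin.init v k ≤ Fin.init v i else Fin.init v k < Fin.init v i))) := by
      constructor
      · intro h
        refine ⟨?_, fun i k hik => ?_⟩
        · have := h (Fin.last m).castSucc (Fin.last (m + 1)) (by simp)
          simpa [finInit_eq] using this
        · have := h i.castSucc k.castSucc (by simpa using hik)
          simpa [finInit_eq] using this
      · rintro ⟨h1, h2⟩ i k hik
        induction k using Fin.lastCases with
        | last =>
          have : i = (Fin.last m).castSucc := by
            ext; simp at hik ⊢; omega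
          subst this
          simpa [finInit_eq] using h1
        | cast k =>
          induction i using Fin.lastCases with
          | last => simp at hik; omega
          | cast i =>
            have := h2 i k (by simpa using hik)
            simpa [finInit_eq] using this
    have hanti : (∀ i k : Fin (m + 1), (k : ℕ) = (i : ℕ) + 1 →
        (if (k : ℕ) ∈ B then Fin.init v k ≤ Fin.init v i else Fin.init v k < Fin.init v i)) →
        ∀ i, Fin.init v (Fin.last m) ≤ Fin.init v i := by
      intro h i
      have : Antitone (Fin.init v : Fin (m + 1) → ℕ) := by
        rw [Fin.antitone_iff_succ_le]
        intro i
        have := h i.castSucc i.succ (by simp)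
        split_ifs at this
        · exact this
        · exact this.le
      exact this (Fin.le_last i)
    have hall : (∀ i : Fin (m + 1 + 1), j < v i) ↔
        (∀ i : Fin (m + 1), j < v i.castSucc) ∧ j < v (Fin.last (m + 1)) := Fin.forall_fin_succ'
    rw [Fin.prod_univ_castSucc]
    simp only [hlast, hall]
    clear hlast hall
    simp only [Tm]
    have hw : ∀ i : Fin (m + 1), v i.castSucc = Fin.init v i := fun i => rfl
    simp only [hw, Fin.val_castSucc, Fin.val_last]
    generalize (Fin.init v : Fin (m + 1) → ℕ) = w at *
    generalize v (Fin.last (m + 1)) = k at *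
    rw [ih, ih]
    simp only [Nat.succ_ne_zero, if_false]
    by_cases hchain : (∀ i k : Fin (m + 1), (k : ℕ) = (i : ℕ) + 1 →
        (if (k : ℕ) ∈ B then w k ≤ w i else w k < w i))
    · have ha := hanti hchain
      by_cases hB : m + 1 ∈ B
      · simp only [if_pos hB, hchain, and_true]
        by_cases hjk : j < k
        · have : (∀ i, k - 1 < w i) ↔ ((∀ i, j < w i) ∧ k ≤ w (Fin.last m)) := by
            constructor
            · intro h
              exact ⟨fun i => by have := h i; omega, by have := h (Fin.last m); omega⟩
            · intro h i
              have := ha i; omega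
          simp only [hjk, if_true, and_true, this, and_assoc]
          split_ifs <;> ring
        · simp [hjk]
      · simp only [if_neg hB, hchain, and_true]
        by_cases hjk : j < k
        · have : (∀ i, k < w i) ↔ ((∀ i, j < w i) ∧ k < w (Fin.last m)) := by
            constructor
            · intro h
              exact ⟨fun i => by have := h i; omega, h (Fin.last m)⟩
            · intro h i
              have := ha i; omega
          simp only [hjk, if_true, and_true, this, and_assoc]
          split_ifs <;> ring
        · simp [hjk]
    · simp only [hchain, and_false, if_false, mul_zero]
      simp

open Classical in
lemma Gfun_eq (β : List ℕ) (z : ℂ) (m : ℕ) (hm : β.sum = m + 1)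
    (h : 0 < z.re + eW (boundarySet β) m) : Gfun β z = Vs z (sWp (boundarySet β) m) 0 := by
  have h1 := hasSum_Tm (boundarySet β) z m 0 (by simpa using h)
  rw [← h1.tsum_eq]
  unfold Gfun Gterm
  generalize boundarySet β = B
  rw [hm]
  refine tsum_congr fun v => ?_
  rw [Tm_eq]

end NewtonMulti

section NewtonComb

open Filter Topology

lemma mem_bd (α : List ℕ) (j : ℕ) :
    j ∈ boundarySet α ↔ ∃ i, 0 < i ∧ i < α.length ∧ (α.take i).sum = j := by
  unfold boundarySet
  rw [List.mem_toFinset, List.mem_iff_getElem]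
  constructor
  · rintro ⟨i, hi, h⟩
    rw [List.getElem_dropLast, List.getElem_drop, List.getElem_scanl, ← List.sum_eq_foldl] at h
    simp at hi
    exact ⟨1 + i, by omega, by omega, h⟩
  · rintro ⟨i, h0, hi, h⟩
    refine ⟨i - 1, by simp; omega, ?_⟩
    rw [List.getElem_dropLast, List.getElem_drop, List.getElem_scanl, ← List.sum_eq_foldl,
      show 1 + (i - 1) = i by omega, h]

lemma mem_bd_append (l : List ℕ) (a j : ℕ) :
    j ∈ boundarySet (l ++ [a]) ↔ ∃ i, 0 < i ∧ i ≤ l.length ∧ (l.take i).sum = j := by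
  rw [mem_bd]
  refine exists_congr fun i => and_congr_right fun _ => ?_
  constructor
  · rintro ⟨h1, h2⟩
    have h1 : i ≤ l.length := by simp at h1; omega
    rw [List.take_append_of_le_length h1] at h2
    exact ⟨h1, h2⟩
  · rintro ⟨h1, h2⟩
    rw [List.take_append_of_le_length h1]
    exact ⟨by simp; omega, h2⟩

lemma sum_take_le (l : List ℕ) (i : ℕ) : (l.take i).sum ≤ l.sum := by
  have := List.sum_take_add_sum_drop l i
  omega

lemma sWp_congr (B B' : Finset ℕ) (m : ℕ) (h : ∀ i, 1 ≤ i → i ≤ m → (i ∈ B ↔ i ∈ B')) (n : ℕ) :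
    sWp B m n = sWp B' m n := by
  induction m generalizing n with
  | zero => simp [sWp]
  | succ m ih =>
    have ih' := ih (fun i h1 h2 => h i h1 (by omega))
    simp only [sWp, ih', h (m + 1) (by omega) le_rfl]

lemma hsum_eq (α : List ℕ) : ∀ m, (∀ a ∈ α, 1 ≤ a) → α.sum = m + 1 → ∀ n,
    (hsum α n : ℂ) = ∑ k ∈ Finset.range n, sWp (boundarySet α.reverse) m k := by
  induction α with
  | nil => intro m _ h; simp at h
  | cons a t ih =>
    intro m hpos hs n
    have hkey : ∀ (b k : ℕ), sWp (boundarySet (t.reverse ++ [a])) (t.sum + b) k =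
        1 / ((k : ℂ) + 1) ^ (b + 1) * (hsum t (k + 1) : ℂ) := by
      intro b k
      induction b with
      | zero =>
        by_cases ht : t = []
        · subst ht
          simp [sWp, hsum]
        · have hts : 1 ≤ t.sum := by
            obtain ⟨c, t', rfl⟩ := List.exists_cons_of_ne_nil ht
            have := hpos c (by simp)
            simp; omega
          obtain ⟨m', hm'⟩ : ∃ m', t.sum = m' + 1 := ⟨t.sum - 1, by omega⟩
          rw [ih m' (fun c hc => hpos c (List.mem_cons_of_mem _ hc)) hm' (k + 1), hm']
          have hin : m' + 1 ∈ boundarySet (t.reverse ++ [a]) := by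
            rw [mem_bd_append]
            refine ⟨t.reverse.length, ?_, le_rfl, ?_⟩
            · simpa using List.length_pos_iff.2 ht
            · rw [List.take_length, List.sum_reverse, hm']
          simp only [sWp, Nat.add_zero, if_pos hin, zero_add, pow_one]
          congr 1
          refine Finset.sum_congr rfl fun x _ => sWp_congr _ _ _ ?_ _
          intro i h1 h2
          rw [mem_bd_append, mem_bd]
          refine exists_congr fun j => and_congr_right fun _ => ?_
          constructor
          · rintro ⟨h3, h4⟩
            refine ⟨lt_of_le_of_ne h3 ?_, h4⟩
            rintro rfl
            rw [List.take_length, List.sum_reverse] at h4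
            omega
          · rintro ⟨h3, h4⟩
            exact ⟨h3.le, h4⟩
      | succ b ihb =>
        have hnot : t.sum + b + 1 ∉ boundarySet (t.reverse ++ [a]) := by
          rw [mem_bd_append]
          rintro ⟨i, _, _, h⟩
          have := sum_take_le t.reverse i
          rw [List.sum_reverse] at this
          omega
        rw [← add_assoc]
        simp only [sWp, if_neg hnot]
        rw [ihb, pow_succ _ (b + 1)]
        have := nat_cast_add_one_ne k
        field_simp
    have ha := hpos a (by simp)
    have hm : m = t.sum + (a - 1) := by simp at hs; omega
    rw [List.reverse_cons, hm]
    simp only [hkey, hsum]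
    push_cast
    rw [Nat.sub_add_cancel ha]

lemma length_diffAux (L : List ℕ) (p : ℕ) : (diffAux p L).length = L.length := by
  induction L generalizing p with
  | nil => rfl
  | cons a t ih => simp [diffAux, ih]

lemma take_diffAux (L : List ℕ) (p : ℕ) (h : (p :: L).Pairwise (· < ·)) (i : ℕ)
    (hi : i < L.length) : p + ((diffAux p L).take (i + 1)).sum = L[i] := by
  induction L generalizing p i with
  | nil => simp at hi
  | cons a t ih =>
    have h1 := (List.pairwise_cons.1 h)
    have hpa := h1.1 a (by simp)
    cases i with
    | zero => simp [diffAux]; omega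
    | succ i =>
      have := ih a h1.2 i (by simpa using hi)
      simp only [diffAux, List.take_succ_cons, List.sum_cons, List.getElem_cons_succ]
      omega

lemma dual_facts (α : List ℕ) (hα : MIdx α) : (dualIdx α).sum = α.sum ∧
    ∀ j, j ∈ boundarySet (dualIdx α) ↔ (1 ≤ j ∧ j < α.sum ∧ j ∉ boundarySet α) := by
  have hM : 1 ≤ α.sum := by
    obtain ⟨c, t', rfl⟩ := List.exists_cons_of_ne_nil hα.1
    have := hα.2 c (by simp)
    simp; omega
  unfold dualIdx
  set S := insert α.sum (Finset.Icc 1 (α.sum - 1) \ boundarySet α) with hS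
  set L := S.sort (· ≤ ·) with hL
  have hmem : ∀ x, x ∈ L ↔ x ∈ S := fun x => Finset.mem_sort _
  have hsort : L.Pairwise (· < ·) := (Finset.sortedLT_sort S).pairwise
  have hSM : ∀ x ∈ S, 1 ≤ x ∧ x ≤ α.sum := by
    intro x hx
    rw [hS, Finset.mem_insert, Finset.mem_sdiff, Finset.mem_Icc] at hx
    omega
  have hcons : (0 :: L).Pairwise (· < ·) :=
    List.pairwise_cons.2 ⟨fun x hx => (hSM x ((hmem x).1 hx)).1, hsort⟩
  have hML : α.sum ∈ L := (hmem _).2 (Finset.mem_insert_self _ _)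
  obtain ⟨i0, hi0, hLi0⟩ := List.mem_iff_getElem.1 hML
  have hmono := List.pairwise_iff_getElem.1 hsort
  have hlast : i0 + 1 = L.length := by
    by_contra hne
    have := hmono i0 (i0 + 1) hi0 (by omega) (by omega)
    have := (hSM _ ((hmem _).1 (List.getElem_mem (l := L) (n := i0 + 1) (by omega)))).2
    omega
  have htake := take_diffAux L 0 hcons
  constructor
  · have := htake i0 hi0
    rw [hlast, ← length_diffAux L 0, List.take_length] at this
    omega
  · intro j
    rw [mem_bd, length_diffAux]
    constructor
    · rintro ⟨i, h0, hi, h⟩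
      obtain ⟨i, rfl⟩ : ∃ i', i = i' + 1 := ⟨i - 1, by omega⟩
      have h1 := htake i (by omega)
      have h2 := hmono i i0 (by omega) hi0 (by omega)
      have h3 := (hmem _).1 (List.getElem_mem (l := L) (n := i) (by omega))
      rw [show L[i] = j by omega] at h2 h3
      rw [hS, Finset.mem_insert, Finset.mem_sdiff, Finset.mem_Icc] at h3
      rcases h3 with h3 | h3
      · omega
      · exact ⟨h3.1.1, by omega, h3.2⟩
    · rintro ⟨h1, h2, h3⟩
      have h4 : j ∈ L := by
        rw [hmem, hS, Finset.mem_insert, Finset.mem_sdiff, Finset.mem_Icc]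
        exact Or.inr ⟨by omega, h3⟩
      obtain ⟨i, hi, h⟩ := List.mem_iff_getElem.1 h4
      have h5 := htake i hi
      refine ⟨i + 1, by omega, ?_, by omega⟩
      by_contra hc
      obtain rfl : i = i0 := by omega
      omega

lemma mem_bd_reverse (α : List ℕ) (j : ℕ) (hj : j ≤ α.sum) :
    j ∈ boundarySet α.reverse ↔ α.sum - j ∈ boundarySet α := by
  rw [mem_bd, mem_bd]
  constructor
  · rintro ⟨i, h0, hi, h⟩
    rw [List.take_reverse, List.sum_reverse] at h
    rw [List.length_reverse] at hi
    have := List.sum_take_add_sum_drop α (α.length - i)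
    exact ⟨α.length - i, by omega, by omega, by omega⟩
  · rintro ⟨i, h0, hi, h⟩
    refine ⟨α.length - i, by omega, by simp; omega, ?_⟩
    rw [List.take_reverse, List.sum_reverse, show α.length - (α.length - i) = i by omega]
    have := List.sum_take_add_sum_drop α i
    omega

lemma le_eW (B : Finset ℕ) (m h : ℕ) (hm : h ≤ m + 1)
    (hB : ∀ i, m + 1 < i + h → i ≤ m → i ∉ B) : h ≤ eW B m := by
  induction m generalizing h with
  | zero => simpa [eW] using hm
  | succ m ih =>
    by_cases h2 : h ≤ 1
    · exact h2.trans (one_le_eW B _)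
    · have h3 := ih (h - 1) (by omega) (fun i h4 h5 => hB i (by omega) (by omega))
      simp only [eW, if_neg (hB (m + 1) (by omega) le_rfl)]
      omega

lemma head_le_bd (β : List ℕ) (j : ℕ) (h : j ∈ boundarySet β) : β.headI ≤ j := by
  obtain ⟨i, h0, hi, h⟩ := (mem_bd β j).1 h
  cases β with
  | nil => simp at hi
  | cons b t =>
    obtain ⟨i, rfl⟩ : ∃ i', i = i' + 1 := ⟨i - 1, by omega⟩
    simp at h ⊢
    omega

lemma head_le_sum (β : List ℕ) : β.headI ≤ β.sum := by
  cases β with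
  | nil => simp
  | cons b t => simp

end NewtonComb

/-- For a multi-index `α` with dual `α* = (α*₁,…,α*_t)` and any `z`
with `Re z > -α*₁`, the Newton series `F_α` interpolating the finite multiple harmonic
sums `S_α` converges at `z` to `G_{α'}(z)`, where `α' = (α*)^τ`. -/
theorem newton_series_eq_multiple_series (α : List ℕ) (hα : MIdx α) (z : ℂ)
    (hz : -(((dualIdx α).headI : ℝ)) < z.re) :
    NewtonSumsTo (fun n => (hsum α n : ℂ)) z (Gfun (dualIdx α).reverse z) := by
  have hM : 1 ≤ α.sum := by
    obtain ⟨c, t', rfl⟩ := List.exists_cons_of_ne_nil hα.1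
    have := hα.2 c (by simp)
    simp; omega
  obtain ⟨m, hm⟩ : ∃ m, α.sum = m + 1 := ⟨α.sum - 1, by omega⟩
  obtain ⟨hsumd, hbd⟩ := dual_facts α hα
  set β := dualIdx α with hβ
  set B := boundarySet α.reverse with hB
  set B' := boundarySet β.reverse with hB'
  have hBB : ∀ i, 1 ≤ i → i ≤ m → (i ∈ B' ↔ i ∉ B) := by
    intro i h1 h2
    rw [hB, hB', mem_bd_reverse β i (by omega), mem_bd_reverse α i (by omega), hbd, hsumd]
    constructor
    · intro h
      exact h.2.2
    · intro h
      exact ⟨by omega, by omega, h⟩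
  have hhead : β.headI ≤ eW B' m := by
    have h1 := head_le_sum β
    refine le_eW B' m _ (by omega) ?_
    intro i h2 h3 h4
    rw [hB', mem_bd_reverse β i (by omega)] at h4
    have := head_le_bd β _ h4
    omega
  have hhead' : (β.headI : ℝ) ≤ eW B' m := by exact_mod_cast hhead
  have hpos : 0 < z.re + eW B' m := by linarith
  rw [Gfun_eq β.reverse z m (by rw [List.sum_reverse, hsumd, hm]) hpos]
  have hh := hsum_eq α m hα.2 hm
  have hdel : delOp (fun n => (hsum α n : ℂ)) = fun n => - sWp B m n := by
    funext n
    simp only [delOp, hh]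
    rw [Finset.sum_range_succ]
    ring
  have hn0 : nablaOp (fun n => (hsum α n : ℂ)) 0 = 0 := by
    simp [nablaOp, hh]
  have hn1 : ∀ n, nablaOp (fun n => (hsum α n : ℂ)) (n + 1) = - sWp B' m n := by
    intro n
    rw [← nabla_sWp B B' m hBB]
    simp only [nablaOp]
    rw [Function.iterate_succ_apply, hdel, iter_delOp_neg]
  unfold NewtonSumsTo NewtonSeriesTo
  rw [← Filter.tendsto_add_atTop_iff_nat 1]
  have hs := (gK_summable z 0 _ (sWp B' m) (Gr_sWp B' m) (by simpa using hpos)).hasSum.tendsto_sum_nat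
  refine hs.congr fun N => ?_
  rw [Finset.sum_range_succ', hn0]
  simp only [hn1, gK, Cc_zero]
  simp only [mul_zero, zero_mul, add_zero]
  refine Finset.sum_congr rfl fun n _ => ?_
  rw [pow_succ]
  push_cast
  ring
end

section
/- For every multi-index α and every n ∈ ℕ, G_α(n) = S_{α'}(n), where α' = (α*)^τ. -/
open scoped BigOperators

namespace KW
open Filter Topology

/-- Tail sums, given by finite recursions in `n`. -/
noncomputable def g (B : Finset ℕ) : ℕ → ℕ → ℕ → ℝ
  | 0, v, n => ∑ i ∈ Finset.range n, 1 / ((v : ℝ) + i + 1)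
  | k + 1, v, n => if k + 1 ∈ B
      then ∑ i ∈ Finset.range n, (g B k v (i + 1) / ((i : ℝ) + 1) - g B k v i / ((v : ℝ) + i + 1))
      else ∑ i ∈ Finset.range n, g B k v (i + 1) / ((i : ℝ) + 1)

/-- Summand at `u + 1`. -/
noncomputable def f (B : Finset ℕ) : ℕ → ℕ → ℕ → ℝ
  | 0, u, n => 1 / ((u : ℝ) + 1) - 1 / ((u : ℝ) + 1 + n)
  | k + 1, u, n => if k + 1 ∈ B then g B k u n / ((u : ℝ) + 1 + n)
      else g B k (u + 1) n / ((u : ℝ) + 1)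

lemma g_zero (B : Finset ℕ) (k v : ℕ) : g B k v 0 = 0 := by
  cases k <;> simp [g]

lemma CD (B : Finset ℕ) (k : ℕ) :
    (∀ u n : ℕ, ((n : ℝ) + 1) * (g B k (u + 1) (n + 1) - g B k (u + 1) n)
      = ((u : ℝ) + 1) * (g B k u (n + 1) - g B k (u + 1) (n + 1))) ∧
    (∀ u n : ℕ, g B k u n - g B k (u + 1) n = f B k u n) := by
  induction k with
  | zero =>
    have D : ∀ u n : ℕ, g B 0 u n - g B 0 (u + 1) n = f B 0 u n := by
      intro u n
      induction n with
      | zero => simp [g, f]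
      | succ n ih =>
        simp only [g, f, Finset.sum_range_succ] at ih ⊢
        push_cast at ih ⊢
        have e : ((u : ℝ) + 1 + n + 1) = u + 1 + (n + 1) := by ring
        have e2 : ((u : ℝ) + n + 1) = u + 1 + n := by ring
        rw [e, e2]
        linarith
    refine ⟨?_, D⟩
    intro u n
    rw [D]
    simp only [g, f, Finset.sum_range_succ]
    have h1 : (u : ℝ) + 1 ≠ 0 := by positivity
    have h2 : (u : ℝ) + 1 + (n + 1) ≠ 0 := by positivity
    have h3 : (u : ℝ) + 1 + n + 1 ≠ 0 := by positivity
    push_cast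
    field_simp
    ring
  | succ k ih =>
    obtain ⟨C, -⟩ := ih
    have D : ∀ u n : ℕ, g B (k + 1) u n - g B (k + 1) (u + 1) n = f B (k + 1) u n := by
      intro u n
      induction n with
      | zero => simp [g_zero, f]
      | succ n ih =>
        have c := C u n
        have h1 : (u : ℝ) + 1 ≠ 0 := by positivity
        have h2 : (u : ℝ) + 1 + (n + 1) ≠ 0 := by positivity
        have h3 : (u : ℝ) + 1 + n + 1 ≠ 0 := by positivity
        have h4 : (u : ℝ) + 1 + n ≠ 0 := by positivity
        have h5 : (u : ℝ) + n + 1 ≠ 0 := by positivity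
        have h6 : (n : ℝ) + 1 ≠ 0 := by positivity
        by_cases hb : k + 1 ∈ B
        · simp only [g, f, hb, if_true, Finset.sum_range_succ] at ih ⊢
          push_cast at ih ⊢
          have c' : g B k u (n + 1) / ((n : ℝ) + 1) - g B k u n / ((u : ℝ) + n + 1)
            - (g B k (u + 1) (n + 1) / ((n : ℝ) + 1) - g B k (u + 1) n / ((u : ℝ) + 1 + n + 1))
            = g B k u (n + 1) / ((u : ℝ) + 1 + (n + 1)) - g B k u n / ((u : ℝ) + 1 + n) := by
            have e2 : ((u : ℝ) + n + 1) = u + 1 + n := by ring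
            have e3 : ((u : ℝ) + 1 + n + 1) = u + 1 + (n + 1) := by ring
            rw [e2, e3]
            have : g B k u (n + 1) / ((n : ℝ) + 1)
              - (g B k (u + 1) (n + 1) / ((n : ℝ) + 1) - g B k (u + 1) n / ((u : ℝ) + 1 + (n + 1)))
              = g B k u (n + 1) / ((u : ℝ) + 1 + (n + 1)) := by
              field_simp
              linarith
            linarith
          linarith
        · simp only [g, f, hb, if_false, Finset.sum_range_succ] at ih ⊢
          have c' : g B k u (n + 1) / ((n : ℝ) + 1) - g B k (u + 1) (n + 1) / ((n : ℝ) + 1)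
            = g B k (u + 1) (n + 1) / ((u : ℝ) + 1) - g B k (u + 1) n / ((u : ℝ) + 1) := by
            field_simp
            linarith
          linarith
    refine ⟨?_, D⟩
    intro u n
    rw [D]
    have c := C u n
    have h1 : (u : ℝ) + 1 ≠ 0 := by positivity
    have h2 : (u : ℝ) + 1 + (n + 1) ≠ 0 := by positivity
    have h6 : (n : ℝ) + 1 ≠ 0 := by positivity
    by_cases hb : k + 1 ∈ B
    · simp only [g, f, hb, if_true, Finset.sum_range_succ]
      push_cast
      have e3 : ((u : ℝ) + 1 + n + 1) = u + 1 + (n + 1) := by ring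
      rw [e3, add_sub_cancel_left]
      field_simp
      linarith
    · simp only [g, f, hb, if_false, Finset.sum_range_succ]
      rw [add_sub_cancel_left]
      field_simp

lemma g_lim (B : Finset ℕ) (k n : ℕ) : Tendsto (fun v => g B k v n) atTop (𝓝 0) := by
  have hc : ∀ i : ℕ, Tendsto (fun v : ℕ => (v : ℝ) + i + 1) atTop atTop := by
    intro i
    exact tendsto_atTop_add_const_right _ _
      (tendsto_atTop_add_const_right _ _ tendsto_natCast_atTop_atTop)
  induction k generalizing n with
  | zero =>
    simp only [g]
    have := tendsto_finsetSum (Finset.range n) (fun i _ => (hc i).const_div_atTop (1 : ℝ))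
    simpa using this
  | succ k ih =>
    by_cases hb : k + 1 ∈ B
    · simp only [g, hb, if_true]
      have := tendsto_finsetSum (Finset.range n)
        (fun i _ => ((ih (i + 1)).div_const ((i : ℝ) + 1)).sub ((ih i).div_atTop (hc i)))
      simpa using this
    · simp only [g, hb, if_false]
      have := tendsto_finsetSum (Finset.range n)
        (fun i _ => ((ih (i + 1)).div_const ((i : ℝ) + 1)))
      simpa using this

lemma fg_nonneg (B : Finset ℕ) (k n : ℕ) : (∀ u, 0 ≤ f B k u n) ∧ (∀ v, 0 ≤ g B k v n) := by
  have key : ∀ k, (∀ u, 0 ≤ f B k u n) → (∀ v, 0 ≤ g B k v n) := by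
    intro k hf v
    have ha : Antitone (fun v => g B k v n) := by
      apply antitone_nat_of_succ_le
      intro u
      have := (CD B k).2 u n
      have := hf u
      linarith
    exact ha.le_of_tendsto (g_lim B k n) v
  induction k with
  | zero =>
    have : ∀ u, 0 ≤ f B 0 u n := by
      intro u
      simp only [f, sub_nonneg]
      apply one_div_le_one_div_of_le (by positivity)
      have : (0 : ℝ) ≤ n := by positivity
      linarith
    exact ⟨this, key 0 this⟩
  | succ k ih =>
    have : ∀ u, 0 ≤ f B (k + 1) u n := by
      intro u
      simp only [f]
      split_ifs
      · exact div_nonneg (ih.2 _) (by positivity)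
      · exact div_nonneg (ih.2 _) (by positivity)
    exact ⟨this, key _ this⟩

lemma hasSum_f (B : Finset ℕ) (k v n : ℕ) :
    HasSum (fun j => f B k (v + j) n) (g B k v n) := by
  rw [hasSum_iff_tendsto_nat_of_nonneg (fun j => (fg_nonneg B k n).1 _)]
  have : ∀ N, ∑ j ∈ Finset.range N, f B k (v + j) n = g B k v n - g B k (v + N) n := by
    intro N
    induction N with
    | zero => simp
    | succ N ih =>
      rw [Finset.sum_range_succ, ih, ← (CD B k).2 (v + N) n]
      rw [← add_assoc]; ring
  simp_rw [this]
  have h := (g_lim B k n).comp (tendsto_add_atTop_nat v)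
  have h2 := h.const_sub (g B k v n)
  simp only [sub_zero] at h2
  refine h2.congr fun N => ?_
  simp [add_comm]

/-- Extended version of the summand. -/
noncomputable def F (B : Finset ℕ) (n k : ℕ) : ℕ → ENNReal
  | 0 => 0
  | u + 1 => ENNReal.ofReal (f B k u n)

lemma tsum_F (B : Finset ℕ) (n k v : ℕ) :
    ∑' y, (if v < y then F B n k y else 0) = ENNReal.ofReal (g B k v n) := by
  have hi : Function.Injective (fun j : ℕ => v + j + 1) := by
    intro a b h; simpa using h
  rw [← hi.tsum_eq]
  · rw [← (hasSum_f B k v n).tsum_eq,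
      ENNReal.ofReal_tsum_of_nonneg (fun j => (fg_nonneg B k n).1 _) (hasSum_f B k v n).summable]
    refine tsum_congr fun j => ?_
    rw [if_pos (by omega)]; rfl
  · intro y hy
    have : v < y := by
      by_contra h; simp [h] at hy
    exact ⟨y - v - 1, by simp only; omega⟩

/-- weights -/
noncomputable def wt (B : Finset ℕ) (n j x : ℕ) : ℝ :=
  if j = 0 then 1 / (x : ℝ) - 1 / ((x : ℝ) + n)
  else if j ∈ B then 1 / ((x : ℝ) + n) else 1 / (x : ℝ)

/-- comparison -/
def cmp (B : Finset ℕ) (k x y : ℕ) : Prop := if k ∈ B then x ≤ y else x < y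

/-- admissible tuples -/
def cond (B : Finset ℕ) (M : ℕ) (v : Fin M → ℕ) : Prop :=
  (∀ j, 0 < v j) ∧ (∀ j k : Fin M, (k : ℕ) = (j : ℕ) + 1 →
        (if (k : ℕ) ∈ B then v k ≤ v j else v k < v j))

open Classical in
/-- extended summand -/
noncomputable def TE (B : Finset ℕ) (n M : ℕ) (v : Fin M → ℕ) : ENNReal :=
  if cond B M v then ∏ j : Fin M, ENNReal.ofReal (wt B n j (v j)) else 0

lemma cond_snoc (B : Finset ℕ) (m : ℕ) (v : Fin (m + 1) → ℕ) (x : ℕ) :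
    cond B (m + 2) (Fin.snoc v x : Fin (m + 2) → ℕ) ↔
      cond B (m + 1) v ∧ 0 < x ∧ cmp B (m + 1) x (v (Fin.last m)) := by
  unfold cond cmp
  constructor
  · rintro ⟨h1, h2⟩
    refine ⟨⟨fun j => ?_, fun j k hjk => ?_⟩, ?_, ?_⟩
    · simpa using h1 j.castSucc
    · simpa using h2 j.castSucc k.castSucc (by simpa using hjk)
    · simpa using h1 (Fin.last _)
    · have := h2 (Fin.last m).castSucc (Fin.last (m + 1)) (by simp)
      simpa only [Fin.snoc_castSucc, Fin.snoc_last, Fin.val_last] using this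
  · rintro ⟨⟨h1, h2⟩, h3, h4⟩
    refine ⟨fun j => ?_, fun j k hjk => ?_⟩
    · refine Fin.lastCases ?_ (fun j => ?_) j
      · simpa using h3
      · simpa using h1 j
    · induction j using Fin.lastCases with
      | last => have := k.2; simp at hjk; omega
      | cast j =>
        induction k using Fin.lastCases with
        | last =>
          have : j = Fin.last m := by
            ext; simp at hjk ⊢; omega
          subst this
          simpa only [Fin.snoc_castSucc, Fin.snoc_last, Fin.val_last] using h4
        | cast k => simpa using h2 j k (by simpa using hjk)

open Classical in
lemma TE_snoc (B : Finset ℕ) (n m : ℕ) (v : Fin (m + 1) → ℕ) (x : ℕ) :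
    TE B n (m + 2) (Fin.snoc v x : Fin (m + 2) → ℕ) =
      TE B n (m + 1) v * (if 0 < x ∧ cmp B (m + 1) x (v (Fin.last m))
        then ENNReal.ofReal (wt B n (m + 1) x) else 0) := by
  unfold TE
  rw [cond_snoc, Fin.prod_univ_castSucc]
  simp only [Fin.snoc_castSucc, Fin.snoc_last, Fin.val_last, Fin.val_castSucc]
  by_cases h1 : cond B (m + 1) v <;>
    by_cases h2 : 0 < x ∧ cmp B (m + 1) x (v (Fin.last m)) <;> simp [h1, h2]

lemma tsum_snoc (m : ℕ) (H : (Fin (m + 1) → ℕ) → ENNReal) :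
    ∑' v, H v = ∑' y : ℕ, ∑' v : Fin m → ℕ, H (Fin.snoc v y : Fin (m + 1) → ℕ) := by
  rw [← (Fin.snocEquiv (fun _ : Fin (m + 1) => ℕ)).tsum_eq H]
  exact ENNReal.tsum_prod (f := fun y v => H (Fin.snoc v y : Fin (m + 1) → ℕ))

open Classical in
lemma tsum_TE_snoc (B : Finset ℕ) (n m x : ℕ) :
    ∑' v : Fin m → ℕ, TE B n (m + 1) (Fin.snoc v x : Fin (m + 1) → ℕ) = F B n m x := by
  induction m generalizing x with
  | zero =>
    rw [tsum_fintype]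
    simp only [Finset.univ_unique, Finset.sum_singleton]
    unfold TE cond
    rcases x with _ | u
    · rw [if_neg]
      · rfl
      · rintro ⟨h, -⟩
        have := h (Fin.last 0)
        simp [Fin.snoc] at this
    · rw [if_pos]
      · simp [Fin.snoc, wt, F, f]
      · refine ⟨fun j => ?_, fun j k h => ?_⟩
        · simp [Fin.snoc]
        · omega
  | succ m ih =>
    simp_rw [TE_snoc]
    rw [tsum_snoc]
    simp only [Fin.snoc_last]
    simp_rw [ENNReal.tsum_mul_right, ih]
    rcases x with _ | u
    · simp [F]
    · by_cases hb : m + 1 ∈ B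
      · have : ∀ y, F B n m y * (if 0 < u + 1 ∧ cmp B (m + 1) (u + 1) y
          then ENNReal.ofReal (wt B n (m + 1) (u + 1)) else 0) =
          (if u < y then F B n m y else 0) * ENNReal.ofReal (wt B n (m + 1) (u + 1)) := by
          intro y
          by_cases h : u < y <;> simp [cmp, hb, h, Nat.succ_le_iff]
        simp_rw [this, ENNReal.tsum_mul_right, tsum_F]
        rw [← ENNReal.ofReal_mul ((fg_nonneg B m n).2 _)]
        simp [F, f, hb, wt, div_eq_mul_inv]
      · have : ∀ y, F B n m y * (if 0 < u + 1 ∧ cmp B (m + 1) (u + 1) y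
          then ENNReal.ofReal (wt B n (m + 1) (u + 1)) else 0) =
          (if u + 1 < y then F B n m y else 0) * ENNReal.ofReal (wt B n (m + 1) (u + 1)) := by
          intro y
          by_cases h : u + 1 < y <;> simp [cmp, hb, h]
        simp_rw [this, ENNReal.tsum_mul_right, tsum_F]
        rw [← ENNReal.ofReal_mul ((fg_nonneg B m n).2 _)]
        simp [F, f, hb, wt, div_eq_mul_inv]

lemma tsum_TE (B : Finset ℕ) (n m : ℕ) :
    ∑' v, TE B n (m + 1) v = ENNReal.ofReal (g B m 0 n) := by
  rw [tsum_snoc]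
  simp_rw [tsum_TE_snoc]
  rw [← tsum_F]
  refine tsum_congr fun y => ?_
  rcases y with _ | y <;> simp [F]

lemma wt_nonneg (B : Finset ℕ) (n j x : ℕ) (hx : 0 < x) : 0 ≤ wt B n j x := by
  unfold wt
  split_ifs
  · rw [sub_nonneg]
    apply one_div_le_one_div_of_le (by positivity)
    have : (0 : ℝ) ≤ n := by positivity
    linarith
  · positivity
  · positivity

open Classical in
lemma tsum_GT (B : Finset ℕ) (n m M : ℕ) (hM : M = m + 1) :
    ∑' v : Fin M → ℕ, (if (∀ j, 0 < v j) ∧ (∀ j k : Fin M, (k : ℕ) = (j : ℕ) + 1 →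
        (if (k : ℕ) ∈ B then v k ≤ v j else v k < v j))
      then ∏ j : Fin M, (if (j : ℕ) = 0 then (1 / (v j : ℂ) - 1 / ((v j : ℂ) + (n : ℂ)))
             else if (j : ℕ) ∈ B then 1 / ((v j : ℂ) + (n : ℂ))
             else 1 / (v j : ℂ))
      else 0) = ((g B m 0 n : ℝ) : ℂ) := by
  subst hM
  have h : (∑' v, TE B n (m + 1) v).toReal = g B m 0 n := by
    rw [tsum_TE, ENNReal.toReal_ofReal ((fg_nonneg B m n).2 _)]
  have hne : ∀ v, TE B n (m + 1) v ≠ ⊤ := by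
    intro v
    unfold TE
    split_ifs
    · exact ENNReal.prod_ne_top (fun _ _ => ENNReal.ofReal_ne_top)
    · simp
  rw [← h, ENNReal.tsum_toReal_eq hne, Complex.ofReal_tsum]
  refine tsum_congr fun v => ?_
  unfold TE
  by_cases hc : cond B (m + 1) v
  · have hc' := hc
    unfold cond at hc'
    rw [if_pos hc', if_pos hc, ENNReal.toReal_prod, Complex.ofReal_prod]
    refine Finset.prod_congr rfl fun j _ => ?_
    rw [ENNReal.toReal_ofReal (wt_nonneg B n j _ (hc.1 j))]
    unfold wt
    split_ifs <;> push_cast <;> rfl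
  · have hc' := hc
    unfold cond at hc'
    rw [if_neg hc', if_neg hc]; simp

/-! the dual index -/

lemma diffAux_append (p : ℕ) (l : List ℕ) (x : ℕ) :
    diffAux p (l ++ [x]) = diffAux p l ++ [x - l.getLastD p] := by
  induction l generalizing p with
  | nil => simp [diffAux]
  | cons a t ih =>
    simp only [List.cons_append, diffAux, ih]
    cases t <;> simp [List.getLastD]

lemma sort_insert_max (s : Finset ℕ) (x : ℕ) (h : ∀ y ∈ s, y < x) :
    (insert x s).sort (· ≤ ·) = s.sort (· ≤ ·) ++ [x] := by
  have hx : x ∉ s := fun hx => lt_irrefl _ (h x hx)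
  have e : insert x s = (s.sort (· ≤ ·) ++ [x]).toFinset := by
    ext y; simp [or_comm]
  rw [e]
  refine (List.toFinset_sort (r := (· ≤ ·)) ?_).2 ?_
  · rw [List.nodup_append]
    refine ⟨Finset.sort_nodup _ _, by simp, ?_⟩
    intro a ha b hb
    simp at ha hb
    subst hb
    exact (h a ha).ne
  · rw [List.pairwise_append]
    refine ⟨Finset.pairwise_sort _ _, by simp, ?_⟩
    intro a ha b hb
    simp at ha hb
    subst hb
    exact (h a ha).le

/-- partial complements -/
def lst (B : Finset ℕ) (k : ℕ) : List ℕ := (Finset.Icc 1 k \ B).sort (· ≤ ·)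

lemma lst_succ (B : Finset ℕ) (k : ℕ) :
    lst B (k + 1) = if k + 1 ∈ B then lst B k else lst B k ++ [k + 1] := by
  unfold lst
  split_ifs with h
  · congr 1
    ext y; simp
    intro hy h1
    constructor
    · intro h2
      rcases Nat.lt_or_ge k y with h3 | h3
      · have : y = k + 1 := by omega
        subst this; contradiction
      · exact h3
    · omega
  · rw [← sort_insert_max]
    · congr 1
      ext y; simp
      constructor
      · rintro ⟨⟨h1, h2⟩, h3⟩
        by_cases h4 : y = k + 1
        · exact Or.inl h4
        · exact Or.inr ⟨⟨h1, by omega⟩, h3⟩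
      · rintro (h1 | ⟨⟨h1, h2⟩, h3⟩)
        · subst h1; exact ⟨⟨by omega, le_rfl⟩, h⟩
        · exact ⟨⟨h1, by omega⟩, h3⟩
    · intro y hy; simp at hy; omega

lemma lst_last (B : Finset ℕ) (k : ℕ) : (lst B k).getLastD 0 ≤ k := by
  induction k with
  | zero => simp [lst]
  | succ k ih =>
    rw [lst_succ]
    split_ifs
    · omega
    · simp

lemma hsum_dual (B : Finset ℕ) (k n : ℕ) :
    hsum (diffAux 0 (lst B k ++ [k + 1])).reverse n = g B k 0 n := by
  induction k generalizing n with
  | zero => simp [lst, diffAux, hsum, g]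
  | succ k ih =>
    rw [lst_succ]
    by_cases hb : k + 1 ∈ B
    · rw [if_pos hb]
      have hl := lst_last B k
      rw [diffAux_append] at ih ⊢
      have e : k + 1 + 1 - (lst B k).getLastD 0 = (k + 1 - (lst B k).getLastD 0) + 1 := by omega
      rw [e]
      simp only [List.reverse_append, List.reverse_cons, List.reverse_nil, List.nil_append,
        List.cons_append] at ih ⊢
      simp only [g, hb, if_true]
      rw [hsum]
      refine Finset.sum_congr rfl fun i _ => ?_
      rw [← ih, ← ih, hsum, hsum, Finset.sum_range_succ]
      push_cast
      rw [zero_add, ← sub_div, add_sub_cancel_left, pow_succ]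
      field_simp
    · rw [if_neg hb, diffAux_append]
      simp only [List.reverse_append, List.reverse_cons, List.reverse_nil, List.nil_append,
        List.cons_append] at ih ⊢
      simp only [g, hb, if_false]
      rw [hsum]
      refine Finset.sum_congr rfl fun i _ => ?_
      rw [← ih]
      simp
      field_simp

end KW

/-- For every multi-index `α` and every `n ∈ ℕ`,
`G_α(n) = S_{α'}(n)` where `α' = (α*)^τ`. -/
theorem Gfun_interpolates (α : List ℕ) (hα : MIdx α) (n : ℕ) :
    Gfun α n = (hsum ((dualIdx α).reverse) n : ℂ) := by
  have hpos : 1 ≤ α.sum := by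
    obtain ⟨h1, h2⟩ := hα
    cases α with
    | nil => exact absurd rfl h1
    | cons a t =>
      have := h2 a (by simp)
      simp only [List.sum_cons]; omega
  obtain ⟨m, hm⟩ : ∃ m, α.sum = m + 1 := ⟨α.sum - 1, by omega⟩
  have h1 := KW.tsum_GT (boundarySet α) n m α.sum hm
  have h2 : dualIdx α = diffAux 0 (KW.lst (boundarySet α) m ++ [m + 1]) := by
    unfold dualIdx KW.lst
    rw [hm, Nat.add_sub_cancel, KW.sort_insert_max]
    intro y hy
    simp at hy
    omega
  rw [h2, KW.hsum_dual, ← h1]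
  rfl
end

section
/- Let α = (α_1,…,α_s) be a multi-index with |α| ≥ 2 and α_s ≥ 2, and let n ∈ ℕ. Then G_α(n) − G_α(n+1) = −G_{α^−}(n+1)/(n+1). -/
open scoped BigOperators

/-! Auxiliary nested sums. -/

/-- The weight at position `j`. -/
noncomputable def wtR (B : Finset ℕ) (z : ℝ) (j x : ℕ) : ℝ :=
  if j = 0 then (1 / (x : ℝ) - 1 / ((x : ℝ) + z))
  else if j ∈ B then 1 / ((x : ℝ) + z) else 1 / (x : ℝ)

/-- The comparison at position `j`. -/
def relB (B : Finset ℕ) (j x y : ℕ) : Prop := if j ∈ B then x ≤ y else x < y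

/-- The condition on tuples. -/
def condB (B : Finset ℕ) (N : ℕ) (v : Fin N → ℕ) : Prop :=
  (∀ j, 0 < v j) ∧ (∀ j k : Fin N, (k : ℕ) = (j : ℕ) + 1 →
        (if (k : ℕ) ∈ B then v k ≤ v j else v k < v j))

open Classical in
/-- Real version of the summand. -/
noncomputable def GtR (B : Finset ℕ) (z : ℝ) (N : ℕ) (v : Fin N → ℕ) : ℝ :=
  if condB B N v then ∏ j : Fin N, wtR B z j (v j) else 0

/-- Prefix sums with prescribed last variable. -/
noncomputable def fR (B : Finset ℕ) (z : ℝ) : ℕ → ℕ → ℝ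
  | 0, x => if x = 0 then 0 else 1 / (x : ℝ) - 1 / ((x : ℝ) + z)
  | j + 1, x => if x = 0 then 0 else
      if j + 1 ∈ B then 1 / ((x : ℝ) + z) * ∑' k, fR B z j (x + k)
      else 1 / (x : ℝ) * ∑' k, fR B z j (x + 1 + k)

lemma Gterm_eq_GtR (α : List ℕ) (z : ℝ) (v : Fin α.sum → ℕ) :
    Gterm α (z : ℂ) v = ((GtR (boundarySet α) z α.sum v : ℝ) : ℂ) := by
  unfold Gterm GtR condB wtR
  split_ifs
  · push_cast
    refine Finset.prod_congr rfl fun j _ => ?_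
    split_ifs <;> push_cast <;> rfl
  · simp

lemma wtR_nonneg (B : Finset ℕ) {z : ℝ} (hz : 0 ≤ z) (j : ℕ) {x : ℕ} (hx : 0 < x) :
    0 ≤ wtR B z j x := by
  have hx' : (0 : ℝ) < x := by exact_mod_cast hx
  unfold wtR
  split_ifs
  · rw [sub_nonneg]
    exact one_div_le_one_div_of_le hx' (by linarith)
  · positivity
  · positivity

lemma GtR_nonneg (B : Finset ℕ) {z : ℝ} (hz : 0 ≤ z) (N : ℕ) (v : Fin N → ℕ) :
    0 ≤ GtR B z N v := by
  unfold GtR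
  split_ifs with h
  · exact Finset.prod_nonneg fun j _ => wtR_nonneg B hz _ (h.1 j)
  · exact le_rfl

lemma condB_snoc (B : Finset ℕ) (N : ℕ) (v : Fin (N + 1) → ℕ) (x : ℕ) :
    condB B (N + 2) (Fin.snoc (α := fun _ => ℕ) v x) ↔
      condB B (N + 1) v ∧ (0 < x ∧ relB B (N + 1) x (v (Fin.last N))) := by
  constructor
  · rintro ⟨h1, h2⟩
    refine ⟨⟨fun j => ?_, fun j k hjk => ?_⟩, ?_, ?_⟩
    · simpa using h1 j.castSucc
    · simpa using h2 j.castSucc k.castSucc (by simpa using hjk)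
    · simpa using h1 (Fin.last _)
    · have := h2 (Fin.last N).castSucc (Fin.last (N + 1)) (by simp)
      simpa only [Fin.snoc_last, Fin.snoc_castSucc, Fin.val_last, relB] using this
  · rintro ⟨⟨h1, h2⟩, h3, h4⟩
    refine ⟨fun j => ?_, fun j k hjk => ?_⟩
    · refine Fin.lastCases ?_ (fun j => ?_) j
      · simpa using h3
      · simpa using h1 j
    · induction k using Fin.lastCases with
      | last =>
        have hj : j = (Fin.last N).castSucc := by
          ext; simp at hjk ⊢; omega
        subst hj
        simpa only [Fin.snoc_last, Fin.snoc_castSucc, Fin.val_last, relB] using h4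
      | cast k =>
        induction j using Fin.lastCases with
        | last => exfalso; have := k.2; simp at hjk; omega
        | cast j => simpa using h2 j k (by simpa using hjk)

open Classical in
/-- The kernel. -/
noncomputable def kerR (B : Finset ℕ) (z : ℝ) (j y x : ℕ) : ℝ :=
  if 0 < x ∧ relB B j x y then wtR B z j x else 0

lemma kerR_nonneg (B : Finset ℕ) {z : ℝ} (hz : 0 ≤ z) (j y x : ℕ) : 0 ≤ kerR B z j y x := by
  unfold kerR
  split_ifs with h
  · exact wtR_nonneg B hz _ h.1
  · exact le_rfl

lemma GtR_snoc (B : Finset ℕ) (z : ℝ) (N : ℕ) (v : Fin (N + 1) → ℕ) (x : ℕ) :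
    GtR B z (N + 2) (Fin.snoc (α := fun _ => ℕ) v x) =
      GtR B z (N + 1) v * kerR B z (N + 1) (v (Fin.last N)) x := by
  unfold GtR kerR
  rw [Fin.prod_univ_castSucc]
  by_cases h1 : condB B (N + 1) v
  · by_cases h2 : 0 < x ∧ relB B (N + 1) x (v (Fin.last N))
    · rw [if_pos ((condB_snoc B N v x).2 ⟨h1, h2⟩), if_pos h1, if_pos h2]
      simp
    · rw [if_neg (fun h => h2 ((condB_snoc B N v x).1 h).2), if_neg h2, mul_zero]
  · rw [if_neg (fun h => h1 ((condB_snoc B N v x).1 h).1), if_neg h1, zero_mul]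

/-! Bounds. -/

/-- The comparison sequence. -/
noncomputable def qs (v : ℕ) : ℝ := 1 / ((v : ℝ) * √v)

lemma qs_nonneg (v : ℕ) : 0 ≤ qs v := by unfold qs; positivity

lemma qs_succ_le (u : ℕ) (hu : 1 ≤ u) : qs (u + 1) ≤ 2 * (1 / √(u : ℝ)) - 2 * (1 / √((u + 1 : ℕ) : ℝ)) := by
  have hu' : (1 : ℝ) ≤ u := by exact_mod_cast hu
  unfold qs
  push_cast
  have ha : 0 < √(u : ℝ) := Real.sqrt_pos.2 (by linarith)
  have hb : 0 < √((u : ℝ) + 1) := Real.sqrt_pos.2 (by linarith)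
  have ha2 : √(u : ℝ) ^ 2 = u := Real.sq_sqrt (by linarith)
  have hb2 : √((u : ℝ) + 1) ^ 2 = u + 1 := Real.sq_sqrt (by linarith)
  have hab : √(u : ℝ) ≤ √((u : ℝ) + 1) := Real.sqrt_le_sqrt (by linarith)
  set a := √(u : ℝ)
  set b := √((u : ℝ) + 1)
  rw [← hb2]
  have e : 2 * (1 / a) - 2 * (1 / b) = 2 / (a * b * (a + b)) := by
    field_simp
    nlinarith
  rw [e, div_le_div_iff₀ (by positivity) (by positivity)]
  have : a * b * (a + b) ≤ b * b * (b + b) := by gcongr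
  nlinarith

lemma qs_partial (v : ℕ) (hv : 1 ≤ v) (n : ℕ) :
    ∑ k ∈ Finset.range n, qs (v + 1 + k) ≤ 2 * (1 / √(v : ℝ)) := by
  have h : ∀ k ∈ Finset.range n, qs (v + 1 + k) ≤
      (fun k : ℕ => 2 * (1 / √((v + k : ℕ) : ℝ))) k - (fun k : ℕ => 2 * (1 / √((v + k : ℕ) : ℝ))) (k + 1) := by
    intro k _
    have := qs_succ_le (v + k) (by omega)
    rw [show v + 1 + k = v + k + 1 by ring]
    simpa [add_assoc] using this
  refine (Finset.sum_le_sum h).trans ?_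
  rw [Finset.sum_range_sub']
  have : 0 ≤ 2 * (1 / √((v + n : ℕ) : ℝ)) := by positivity
  simp only [add_zero]
  linarith

lemma qs_summable : Summable qs := by
  have h : Summable (fun k => qs (1 + 1 + k)) :=
    summable_of_sum_range_le (fun _ => qs_nonneg _) (qs_partial 1 le_rfl)
  rw [← summable_nat_add_iff (1 + 1)]
  simpa [add_comm] using h

lemma summable_shift {f : ℕ → ℝ} (hf : Summable f) (v : ℕ) : Summable (fun k => f (v + k)) := by
  have := (summable_nat_add_iff v).2 hf
  simpa [add_comm] using this

lemma qs_tail_strict (v : ℕ) (hv : 1 ≤ v) : ∑' k, qs (v + 1 + k) ≤ 2 * (1 / √(v : ℝ)) :=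
  Real.tsum_le_of_sum_range_le (fun _ => qs_nonneg _) (qs_partial v hv)

lemma tail_split {f : ℕ → ℝ} (hf : Summable f) (v : ℕ) :
    ∑' k, f (v + k) = f v + ∑' k, f (v + 1 + k) := by
  rw [(summable_shift hf v).tsum_eq_zero_add]
  simp only [add_zero]
  congr 1
  refine tsum_congr fun k => ?_
  congr 1; ring

lemma qs_tail_weak (v : ℕ) (hv : 1 ≤ v) : ∑' k, qs (v + k) ≤ 3 * (1 / √(v : ℝ)) := by
  rw [tail_split qs_summable]
  have := qs_tail_strict v hv
  have hv' : (1 : ℝ) ≤ v := by exact_mod_cast hv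
  have h2 : qs v ≤ 1 / √(v : ℝ) := by
    unfold qs
    have : 0 < √(v : ℝ) := Real.sqrt_pos.2 (by linarith)
    apply one_div_le_one_div_of_le this
    nlinarith
  linarith

lemma fR_zero_right (B : Finset ℕ) (z : ℝ) (j : ℕ) : fR B z j 0 = 0 := by
  cases j <;> simp [fR]

lemma fR_bound (B : Finset ℕ) {z : ℝ} (hz : 0 ≤ z) (j : ℕ) :
    (∀ v, 0 ≤ fR B z j v) ∧ ∃ C : ℝ, 0 ≤ C ∧ ∀ v, fR B z j v ≤ C * qs v := by
  induction j with
  | zero =>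
    constructor
    · intro v
      rcases Nat.eq_zero_or_pos v with rfl | hv
      · simp [fR]
      · have := wtR_nonneg B hz 0 hv
        simpa [fR, wtR, hv.ne'] using this
    · refine ⟨z, hz, fun v => ?_⟩
      rcases Nat.eq_zero_or_pos v with rfl | hv
      · simp [fR, qs]
      · have hv' : (1 : ℝ) ≤ v := by exact_mod_cast hv
        simp only [fR, hv.ne', if_false, qs]
        have hs : 0 < √(v : ℝ) := Real.sqrt_pos.2 (by linarith)
        have hsv : √(v : ℝ) ≤ v := by
          rw [Real.sqrt_le_left (by linarith)]; nlinarith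
        have e : 1 / (v : ℝ) - 1 / (v + z) = z * (1 / (v * (v + z))) := by
          have : (v : ℝ) + z ≠ 0 := by positivity
          field_simp
          ring
        rw [e]
        gcongr
        linarith
  | succ j ih =>
    obtain ⟨h0, C, hC, hb⟩ := ih
    have hs : Summable (fR B z j) :=
      Summable.of_nonneg_of_le h0 hb (qs_summable.mul_left C)
    have htail : ∀ v, ∑' k, fR B z j (v + k) ≤ C * ∑' k, qs (v + k) := by
      intro v
      rw [← tsum_mul_left]
      exact Summable.tsum_le_tsum (fun k => hb _) (summable_shift hs v)
        ((summable_shift qs_summable v).mul_left C)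
    constructor
    · intro v
      have a1 : ∀ v, 0 ≤ ∑' k, fR B z j (v + k) := fun v => tsum_nonneg fun k => h0 _
      have := a1 v
      have := a1 (v + 1)
      simp only [fR]
      split_ifs <;> positivity
    · refine ⟨3 * C, by positivity, fun v => ?_⟩
      rcases Nat.eq_zero_or_pos v with rfl | hv
      · simp [fR, qs]
      · have hv' : (1 : ℝ) ≤ v := by exact_mod_cast hv
        have hs' : 0 < √(v : ℝ) := Real.sqrt_pos.2 (by linarith)
        have key : ∀ S w : ℝ, S ≤ C * (3 * (1 / √(v : ℝ))) → 0 ≤ w → w ≤ 1 / (v : ℝ) →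
            w * S ≤ 3 * C * qs v := by
          intro S w hS hw hw'
          calc w * S ≤ w * (C * (3 * (1 / √(v : ℝ)))) := by gcongr
            _ ≤ (1 / (v : ℝ)) * (C * (3 * (1 / √(v : ℝ)))) := by gcongr
            _ = 3 * C * qs v := by unfold qs; field_simp
        simp only [fR, hv.ne', if_false]
        split_ifs
        · refine key _ _ ((htail v).trans ?_) (by positivity)
            (one_div_le_one_div_of_le (by linarith) (by linarith))
          gcongr
          exact qs_tail_weak v hv
        · refine key _ _ ((htail (v + 1)).trans ?_) (by positivity) le_rfl
          gcongr
          refine (qs_tail_strict v hv).trans ?_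
          gcongr
          norm_num

lemma fR_summable (B : Finset ℕ) {z : ℝ} (hz : 0 ≤ z) (j : ℕ) : Summable (fR B z j) := by
  obtain ⟨h0, C, hC, hb⟩ := fR_bound B hz j
  exact Summable.of_nonneg_of_le h0 hb (qs_summable.mul_left C)

/-! Reduction of the multiple sum. -/

lemma tsum_ge_indicator (g : ℕ → ENNReal) (x : ℕ) :
    ∑' y, (if x ≤ y then g y else 0) = ∑' k, g (x + k) := by
  have hinj : Function.Injective (fun k : ℕ => x + k) := fun a b h => by simpa using h
  have : ∑' k, (fun y => if x ≤ y then g y else 0) (x + k) =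
      ∑' y, (if x ≤ y then g y else 0) := by
    refine Function.Injective.tsum_eq (f := fun y => if x ≤ y then g y else 0) hinj ?_
    intro y hy
    have : x ≤ y := by
      by_contra h
      simp [h] at hy
    exact ⟨y - x, by simp; omega⟩
  rw [← this]
  simp

lemma fR_succ_ennreal (B : Finset ℕ) {z : ℝ} (hz : 0 ≤ z) (j x : ℕ) :
    ∑' y, ENNReal.ofReal (fR B z j y) * ENNReal.ofReal (kerR B z (j + 1) y x) =
      ENNReal.ofReal (fR B z (j + 1) x) := by
  obtain ⟨h0, -⟩ := fR_bound B hz j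
  have hs := fR_summable B hz j
  rcases Nat.eq_zero_or_pos x with rfl | hx
  · simp [kerR, fR]
  have hw := wtR_nonneg B hz (j + 1) hx
  have tail : ∀ v, ENNReal.ofReal (∑' k, fR B z j (v + k)) =
      ∑' y, (if v ≤ y then ENNReal.ofReal (fR B z j y) else 0) := by
    intro v
    rw [tsum_ge_indicator, ENNReal.ofReal_tsum_of_nonneg (fun _ => h0 _) (summable_shift hs v)]
  by_cases hB : j + 1 ∈ B
  · have : fR B z (j + 1) x = wtR B z (j + 1) x * ∑' k, fR B z j (x + k) := by
      simp [fR, wtR, hx.ne', hB]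
    rw [this, ENNReal.ofReal_mul hw, tail, ← ENNReal.tsum_mul_left]
    refine tsum_congr fun y => ?_
    simp only [kerR, hx, relB, hB, if_true, true_and]
    split_ifs <;> simp [mul_comm]
  · have : fR B z (j + 1) x = wtR B z (j + 1) x * ∑' k, fR B z j (x + 1 + k) := by
      simp [fR, wtR, hx.ne', hB]
    rw [this, ENNReal.ofReal_mul hw, tail, ← ENNReal.tsum_mul_left]
    refine tsum_congr fun y => ?_
    simp only [kerR, hx, relB, hB, if_false, true_and, Nat.succ_le_iff]
    split_ifs <;> simp [mul_comm]

lemma tsum_snoc (N : ℕ) (F : (Fin (N + 1) → ℕ) → ENNReal) :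
    ∑' v, F v = ∑' v : Fin N → ℕ, ∑' x : ℕ, F (Fin.snoc (α := fun _ => ℕ) v x) := by
  rw [← (Fin.snocEquiv (fun _ : Fin (N + 1) => ℕ)).tsum_eq, ENNReal.tsum_prod', ENNReal.tsum_comm]
  rfl

lemma main_ennreal (B : Finset ℕ) {z : ℝ} (hz : 0 ≤ z) (N : ℕ) : ∀ h : ℕ → ENNReal,
    ∑' v : Fin (N + 1) → ℕ, ENNReal.ofReal (GtR B z (N + 1) v) * h (v (Fin.last N)) =
      ∑' x, ENNReal.ofReal (fR B z N x) * h x := by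
  induction N with
  | zero =>
    intro h
    rw [← (Equiv.funUnique (Fin 1) ℕ).symm.tsum_eq]
    refine tsum_congr fun x => ?_
    congr 2
    rcases Nat.eq_zero_or_pos x with rfl | hx
    · simp [GtR, condB, fR]
    · have hc : condB B 1 ((Equiv.funUnique (Fin 1) ℕ).symm x) := by
        refine ⟨fun j => by simpa using hx, fun j k hjk => ?_⟩
        have := k.2; omega
      unfold GtR
      rw [if_pos hc]
      simp [wtR, fR, hx.ne']
  | succ N ih =>
    intro h
    rw [tsum_snoc]
    have e1 : ∀ (v : Fin (N + 1) → ℕ), (∑' x : ℕ, ENNReal.ofReal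
        (GtR B z (N + 1 + 1) (Fin.snoc (α := fun _ => ℕ) v x)) *
          h ((Fin.snoc (α := fun _ => ℕ) v x : Fin (N + 2) → ℕ) (Fin.last (N + 1)))) =
        ENNReal.ofReal (GtR B z (N + 1) v) *
          (fun y => ∑' x, ENNReal.ofReal (kerR B z (N + 1) y x) * h x) (v (Fin.last N)) := by
      intro v
      simp only
      rw [← ENNReal.tsum_mul_left]
      refine tsum_congr fun x => ?_
      rw [GtR_snoc, Fin.snoc_last, ENNReal.ofReal_mul (GtR_nonneg B hz _ _), mul_assoc]
    rw [tsum_congr e1, ih (fun y => ∑' x, ENNReal.ofReal (kerR B z (N + 1) y x) * h x)]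
    simp_rw [← ENNReal.tsum_mul_left]
    rw [ENNReal.tsum_comm]
    refine tsum_congr fun x => ?_
    rw [← fR_succ_ennreal B hz, ← ENNReal.tsum_mul_right]
    refine tsum_congr fun y => ?_
    rw [mul_assoc]

lemma tsum_GtR (B : Finset ℕ) {z : ℝ} (hz : 0 ≤ z) (N : ℕ) :
    ∑' v : Fin (N + 1) → ℕ, GtR B z (N + 1) v = ∑' x, fR B z N x := by
  have h := main_ennreal B hz N (fun _ => 1)
  simp only [mul_one] at h
  have h' := congrArg ENNReal.toReal h
  rw [ENNReal.tsum_toReal_eq (fun _ => ENNReal.ofReal_ne_top),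
    ENNReal.tsum_toReal_eq (fun _ => ENNReal.ofReal_ne_top)] at h'
  have h0 := (fR_bound B hz N).1
  simpa [ENNReal.toReal_ofReal, GtR_nonneg B hz, h0] using h'

lemma Gfun_eq_s2 (α : List ℕ) {z : ℝ} (hz : 0 ≤ z) (N : ℕ) (hN : α.sum = N + 1) :
    Gfun α (z : ℂ) = ((∑' x, fR (boundarySet α) z N x : ℝ) : ℂ) := by
  unfold Gfun
  rw [tsum_congr (Gterm_eq_GtR α z), ← Complex.ofReal_tsum, hN, tsum_GtR _ hz]

/-! The invariant. -/

lemma telescope {D H : ℕ → ℝ} (hD : Summable D)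
    (hstep : ∀ v, 1 ≤ v → D (v + 1) = H v - H (v + 1))
    (hH : Filter.Tendsto H Filter.atTop (nhds 0)) (v : ℕ) (hv : 1 ≤ v) :
    ∑' k, D (v + 1 + k) = H v := by
  have h1 := (summable_shift hD (v + 1)).hasSum.tendsto_sum_nat
  have h2 : ∀ n, ∑ k ∈ Finset.range n, D (v + 1 + k) = H v - H (v + n) := by
    intro n
    have : ∀ k ∈ Finset.range n, D (v + 1 + k) =
        (fun k => H (v + k)) k - (fun k => H (v + k)) (k + 1) := by
      intro k _
      have := hstep (v + k) (by omega)
      rw [show v + 1 + k = v + k + 1 by ring, this]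
      rfl
    rw [Finset.sum_congr rfl this, Finset.sum_range_sub']
    simp
  simp_rw [h2] at h1
  have h3 : Filter.Tendsto (fun n => H v - H (v + n)) Filter.atTop (nhds (H v - 0)) := by
    refine Filter.Tendsto.const_sub _ (hH.comp ?_)
    exact Filter.tendsto_atTop_mono (fun n => Nat.le_add_left n v) Filter.tendsto_id
  rw [tendsto_nhds_unique h1 h3, sub_zero]

lemma vf_tendsto (B : Finset ℕ) {z : ℝ} (hz : 0 ≤ z) (j : ℕ) (c : ℝ) :
    Filter.Tendsto (fun v : ℕ => -((v : ℝ) / c) * fR B z j v) Filter.atTop (nhds 0) := by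
  obtain ⟨h0, C, hC, hb⟩ := fR_bound B hz j
  have h1 : Filter.Tendsto (fun v : ℕ => (v : ℝ) * fR B z j v) Filter.atTop (nhds 0) := by
    have hs : Filter.Tendsto (fun v : ℕ => C * (1 / √(v : ℝ))) Filter.atTop (nhds (C * 0)) := by
      refine Filter.Tendsto.const_mul _ ?_
      simp only [one_div]
      exact tendsto_inv_atTop_zero.comp (Real.tendsto_sqrt_atTop.comp tendsto_natCast_atTop_atTop)
    rw [mul_zero] at hs
    refine squeeze_zero (fun v => mul_nonneg (by positivity) (h0 v)) (fun v => ?_) hs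
    rcases Nat.eq_zero_or_pos v with rfl | hv
    · simp
    · have hv' : (0 : ℝ) < v := by exact_mod_cast hv
      have hs' : 0 < √(v : ℝ) := Real.sqrt_pos.2 hv'
      calc (v : ℝ) * fR B z j v ≤ v * (C * qs v) := by gcongr; exact hb v
        _ = C * (1 / √(v : ℝ)) := by unfold qs; field_simp
  have := h1.const_mul (-(1 / c))
  rw [mul_zero] at this
  refine this.congr fun v => ?_
  ring

lemma invariant (B : Finset ℕ) {z : ℝ} (hz : 0 ≤ z) (j : ℕ) : ∀ v, 1 ≤ v →
    ∑' k, (fR B z j (v + 1 + k) - fR B (z + 1) j (v + 1 + k)) =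
      -((v : ℝ) / (z + 1)) * fR B (z + 1) j v := by
  have hw : 0 ≤ z + 1 := by linarith
  induction j with
  | zero =>
    refine telescope (D := fun v => fR B z 0 v - fR B (z + 1) 0 v)
      (H := fun v => -((v : ℝ) / (z + 1)) * fR B (z + 1) 0 v)
      ((fR_summable B hz 0).sub (fR_summable B hw 0)) (fun v hv => ?_) (vf_tendsto B hw 0 _)
    have hv' : (1 : ℝ) ≤ v := by exact_mod_cast hv
    have hv0 : v ≠ 0 := by omega
    simp only [fR, hv0, Nat.succ_ne_zero, if_false]
    push_cast
    have a1 : (v : ℝ) + 1 + z ≠ 0 := by positivity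
    have a2 : (v : ℝ) + 1 + (z + 1) ≠ 0 := by positivity
    have a3 : (v : ℝ) + (z + 1) ≠ 0 := by positivity
    have a4 : z + 1 ≠ 0 := by positivity
    have a5 : (v : ℝ) + 1 ≠ 0 := by positivity
    have a6 : (v : ℝ) ≠ 0 := by positivity
    field_simp
    ring
  | succ j ih =>
    have sz := fR_summable B hz j
    have sw := fR_summable B hw j
    have ih' : ∀ v, 1 ≤ v → ∑' k, fR B z j (v + 1 + k) =
        ∑' k, fR B (z + 1) j (v + 1 + k) - ((v : ℝ) / (z + 1)) * fR B (z + 1) j v := by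
      intro v hv
      have := ih v hv
      rw [(summable_shift sz (v + 1)).tsum_sub (summable_shift sw (v + 1))] at this
      linarith
    refine telescope (D := fun v => fR B z (j + 1) v - fR B (z + 1) (j + 1) v)
      (H := fun v => -((v : ℝ) / (z + 1)) * fR B (z + 1) (j + 1) v)
      ((fR_summable B hz _).sub (fR_summable B hw _)) (fun v hv => ?_) (vf_tendsto B hw _ _)
    have hv' : (1 : ℝ) ≤ v := by exact_mod_cast hv
    have hv0 : v ≠ 0 := by omega
    have a1 : (v : ℝ) + 1 + z ≠ 0 := by positivity
    have a2 : (v : ℝ) + 1 + (z + 1) ≠ 0 := by positivity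
    have a3 : (v : ℝ) + (z + 1) ≠ 0 := by positivity
    have a4 : z + 1 ≠ 0 := by positivity
    have a5 : (v : ℝ) + 1 ≠ 0 := by positivity
    have a6 : (v : ℝ) ≠ 0 := by positivity
    simp only [fR, hv0, Nat.succ_ne_zero, if_false]
    by_cases hB : j + 1 ∈ B
    · simp only [hB, if_true]
      rw [ih' v hv, tail_split sw v]
      push_cast
      generalize (∑' k, fR B (z + 1) j (v + 1 + k)) = Q
      generalize fR B (z + 1) j v = q
      field_simp
      ring
    · simp only [hB, if_false]
      rw [ih' (v + 1) (by omega), tail_split sw (v + 1)]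
      push_cast
      generalize (∑' k, fR B (z + 1) j (v + 1 + 1 + k)) = Q
      generalize fR B (z + 1) j (v + 1) = q
      field_simp
      ring

lemma final_real (B : Finset ℕ) {z : ℝ} (hz : 0 ≤ z) (j : ℕ) (hB : j + 1 ∉ B) :
    ∑' v, fR B z (j + 1) v - ∑' v, fR B (z + 1) (j + 1) v =
      -(1 / (z + 1)) * ∑' v, fR B (z + 1) j v := by
  have hw : 0 ≤ z + 1 := by linarith
  rw [← (fR_summable B hz _).tsum_sub (fR_summable B hw _), ← tsum_mul_left]
  refine tsum_congr fun v => ?_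
  rcases Nat.eq_zero_or_pos v with rfl | hv
  · simp [fR_zero_right]
  · have := invariant B hz j v hv
    rw [(summable_shift (fR_summable B hz j) (v + 1)).tsum_sub
      (summable_shift (fR_summable B hw j) (v + 1))] at this
    have hv' : (1 : ℝ) ≤ v := by exact_mod_cast hv
    have hv0 : v ≠ 0 := by omega
    simp only [fR, hv0, hB, if_false]
    rw [← mul_sub, this]
    have a6 : (v : ℝ) ≠ 0 := by positivity
    field_simp

/-! Combinatorics of the boundary set. -/

lemma boundarySet_append (l : List ℕ) (a : ℕ) :
    boundarySet (l ++ [a]) = ((List.scanl (· + ·) 0 l).drop 1).toFinset := by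
  unfold boundarySet
  congr 1
  rw [List.scanl_append]
  cases l with
  | nil => simp
  | cons b t => simp [List.scanl_cons]

lemma scanl_le (l : List ℕ) : ∀ c x, x ∈ List.scanl (· + ·) c l → x ≤ c + l.sum := by
  induction l with
  | nil => intro c x h; simp at h; simp [h]
  | cons b t ih =>
    intro c x h
    rw [List.scanl_cons, List.mem_cons] at h
    rcases h with rfl | h
    · omega
    · have := ih _ _ h
      simp only [List.sum_cons]; omega

theorem Gfun_diff_of_two_le_last (α : List ℕ) (hα : MIdx α) (hw : 2 ≤ α.sum)
    (hlast : 2 ≤ α.getLastD 0) (n : ℕ) :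
    Gfun α n - Gfun α ((n : ℂ) + 1) =
      -(1 / ((n : ℂ) + 1)) * Gfun (rminus α) ((n : ℂ) + 1) := by
  obtain ⟨l, a, rfl⟩ : ∃ l a, α = l ++ [a] :=
    ⟨α.dropLast, α.getLast hα.1, (List.dropLast_append_getLast hα.1).symm⟩
  have hl : (l ++ [a]).getLastD 0 = a := by simp
  rw [hl] at hlast
  have hr : rminus (l ++ [a]) = l ++ [a - 1] := by
    unfold rminus
    rw [hl, if_pos hlast, List.dropLast_concat]
  rw [hr]
  obtain ⟨M, hM⟩ : ∃ M, (l ++ [a]).sum = M + 2 := ⟨(l ++ [a]).sum - 2, by omega⟩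
  have hM' : (l ++ [a - 1]).sum = M + 1 := by
    simp at hM ⊢; omega
  have hb : boundarySet (l ++ [a - 1]) = boundarySet (l ++ [a]) := by
    rw [boundarySet_append, boundarySet_append]
  have hnB : M + 1 ∉ boundarySet (l ++ [a]) := by
    rw [boundarySet_append, List.mem_toFinset]
    intro h
    have := scanl_le _ _ _ (List.mem_of_mem_drop h)
    simp at hM
    omega
  have hz : (0 : ℝ) ≤ n := by positivity
  have hz1 : (0 : ℝ) ≤ (n : ℝ) + 1 := by positivity
  have c0 : (n : ℂ) = ((n : ℝ) : ℂ) := by simp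
  have c1 : (n : ℂ) + 1 = (((n : ℝ) + 1 : ℝ) : ℂ) := by simp
  rw [c1, c0, Gfun_eq_s2 _ hz (M + 1) hM, Gfun_eq_s2 _ hz1 (M + 1) hM, Gfun_eq_s2 _ hz1 M hM', hb]
  have := final_real (boundarySet (l ++ [a])) hz M hnB
  rw [← Complex.ofReal_sub, this]
  push_cast
  ring
end

section
/- Let α = (α_1,…,α_s) be a multi-index with |α| ≥ 2 and α_s = 1, and let n ∈ ℕ. Then G_α(n) − G_α(n+1) = (G_{α^−}(n) − G_{α^−}(n+1))/(n+1). -/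
open scoped BigOperators

/-! ### Real nested sums -/

/-- The summand of the innermost variable of the nested sum with `m+1` variables. -/
noncomputable def tmF (S : Finset ℕ) (n : ℕ) : ℕ → ℕ → ℝ
  | 0, v => 1 / (v : ℝ) - 1 / ((v : ℝ) + n)
  | m + 1, v => if m + 1 ∈ S then (1 / ((v : ℝ) + n)) * (∑' i, tmF S n m (v - 1 + 1 + i))
      else (1 / (v : ℝ)) * (∑' i, tmF S n m (v + 1 + i))

/-- The nested sum with `m+1` variables, all greater than `k`. -/
noncomputable def FF (S : Finset ℕ) (n m k : ℕ) : ℝ := ∑' i, tmF S n m (k + 1 + i)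

lemma tmF_succ (S : Finset ℕ) (n m v : ℕ) : tmF S n (m + 1) v =
    if m + 1 ∈ S then (1 / ((v : ℝ) + n)) * FF S n m (v - 1)
      else (1 / (v : ℝ)) * FF S n m v := rfl

lemma tele_hasSum (k : ℕ) : HasSum (fun i : ℕ => (1 : ℝ) / ((k + 1 + i : ℕ) : ℝ)
    - 1 / ((k + 1 + (i + 1) : ℕ) : ℝ)) (1 / ((k : ℝ) + 1)) := by
  rw [hasSum_iff_tendsto_nat_of_nonneg]
  · have h : ∀ N : ℕ, ∑ i ∈ Finset.range N, ((1 : ℝ) / ((k + 1 + i : ℕ) : ℝ)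
        - 1 / ((k + 1 + (i + 1) : ℕ) : ℝ)) = 1 / ((k : ℝ) + 1) - 1 / ((k + 1 + N : ℕ) : ℝ) := by
      intro N
      rw [Finset.sum_range_sub' (fun i : ℕ => (1 : ℝ) / ((k + 1 + i : ℕ) : ℝ))]
      simp
    simp_rw [h]
    have h2 : Filter.Tendsto (fun N : ℕ => (1 : ℝ) / ((k + 1 + N : ℕ) : ℝ)) Filter.atTop (nhds 0) := by
      have := (tendsto_one_div_atTop_nhds_zero_nat (𝕜 := ℝ)).comp (Filter.tendsto_add_atTop_nat (k + 1))
      refine this.congr fun N => ?_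
      simp only [Function.comp]
      rw [add_comm]
    simpa using tendsto_const_nhds.sub h2
  · intro i
    rw [sub_nonneg]
    apply one_div_le_one_div_of_le
    · positivity
    · push_cast; linarith

lemma tail_bound (g : ℕ → ℝ) (C : ℝ) (h0 : ∀ v, 1 ≤ v → 0 ≤ g v)
    (h1 : ∀ v, 1 ≤ v → g v ≤ C / (v : ℝ) ^ 2) (k : ℕ) :
    Summable (fun i => g (k + 1 + i)) ∧ 0 ≤ ∑' i, g (k + 1 + i) ∧
      ∑' i, g (k + 1 + i) ≤ 2 * C / ((k : ℝ) + 1) := by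
  have hC : 0 ≤ C := by
    have := (h0 1 le_rfl).trans (h1 1 le_rfl)
    simpa using this
  have ht := (tele_hasSum k).mul_left (2 * C)
  have hle : ∀ i : ℕ, g (k + 1 + i) ≤ 2 * C * ((1 : ℝ) / ((k + 1 + i : ℕ) : ℝ)
    - 1 / ((k + 1 + (i + 1) : ℕ) : ℝ)) := by
    intro i
    refine (h1 _ (by omega)).trans ?_
    have hx : (1 : ℝ) ≤ ((k + 1 + i : ℕ) : ℝ) := by exact_mod_cast (by omega : 1 ≤ k + 1 + i)
    have e : ((k + 1 + (i + 1) : ℕ) : ℝ) = ((k + 1 + i : ℕ) : ℝ) + 1 := by push_cast; ring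
    rw [e]
    generalize ((k + 1 + i : ℕ) : ℝ) = x at hx
    have : 2 * C * (1 / x - 1 / (x + 1)) = 2 * C / (x * (x + 1)) := by
      field_simp; ring
    rw [this, div_le_div_iff₀ (by positivity) (by positivity)]
    nlinarith [mul_nonneg hC (by nlinarith : 0 ≤ x ^ 2 - x)]
  have hs : Summable (fun i => g (k + 1 + i)) :=
    Summable.of_nonneg_of_le (fun i => h0 _ (by omega)) hle ht.summable
  refine ⟨hs, tsum_nonneg (fun i => h0 _ (by omega)), ?_⟩
  have := hs.tsum_le_tsum hle ht.summable
  rw [ht.tsum_eq] at this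
  calc _ ≤ _ := this
    _ = _ := by ring

lemma tmF_bound (S : Finset ℕ) (n m : ℕ) : ∃ C : ℝ, ∀ v, 1 ≤ v →
    0 ≤ tmF S n m v ∧ tmF S n m v ≤ C / (v : ℝ) ^ 2 := by
  induction m with
  | zero =>
    refine ⟨n, fun v hv => ?_⟩
    have hx : (1 : ℝ) ≤ (v : ℝ) := by exact_mod_cast hv
    have hn : (0 : ℝ) ≤ n := by positivity
    simp only [tmF]
    generalize (v : ℝ) = x at hx
    generalize (n : ℝ) = y at hn
    have : 1 / x - 1 / (x + y) = y / (x * (x + y)) := by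
      field_simp; ring
    rw [this]
    refine ⟨by positivity, ?_⟩
    apply div_le_div_of_nonneg_left hn (by positivity)
    nlinarith
  | succ m ih =>
    obtain ⟨C, hC⟩ := ih
    have hC0 : 0 ≤ C := by
      have := (hC 1 le_rfl).1.trans (hC 1 le_rfl).2
      simpa using this
    have hb := tail_bound (tmF S n m) C (fun v hv => (hC v hv).1) (fun v hv => (hC v hv).2)
    refine ⟨2 * C, fun v hv => ?_⟩
    have hx : (1 : ℝ) ≤ (v : ℝ) := by exact_mod_cast hv
    rw [tmF_succ]
    split_ifs
    · obtain ⟨-, h0, h1⟩ := hb (v - 1)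
      have e : ((v - 1 : ℕ) : ℝ) + 1 = v := by
        rw [Nat.cast_sub hv]; simp
      rw [e] at h1
      change 0 ≤ FF S n m (v - 1) at h0
      change FF S n m (v - 1) ≤ _ at h1
      refine ⟨by positivity, ?_⟩
      calc 1 / ((v : ℝ) + n) * FF S n m (v - 1) ≤ 1 / (v : ℝ) * (2 * C / v) := by
            gcongr
            simp
        _ = _ := by field_simp
    · obtain ⟨-, h0, h1⟩ := hb v
      change 0 ≤ FF S n m v at h0
      change FF S n m v ≤ _ at h1
      refine ⟨by positivity, ?_⟩
      calc 1 / (v : ℝ) * FF S n m v ≤ 1 / (v : ℝ) * (2 * C / v) := by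
            gcongr
            refine h1.trans ?_
            gcongr
            simp
        _ = _ := by field_simp

lemma tmF_summable (S : Finset ℕ) (n m k : ℕ) : Summable (fun i => tmF S n m (k + 1 + i)) := by
  obtain ⟨C, hC⟩ := tmF_bound S n m
  exact (tail_bound (tmF S n m) C (fun v hv => (hC v hv).1) (fun v hv => (hC v hv).2) k).1

lemma FF_nonneg (S : Finset ℕ) (n m k : ℕ) : 0 ≤ FF S n m k := by
  obtain ⟨C, hC⟩ := tmF_bound S n m
  exact (tail_bound (tmF S n m) C (fun v hv => (hC v hv).1) (fun v hv => (hC v hv).2) k).2.1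

lemma FF_tendsto (S : Finset ℕ) (n m : ℕ) :
    Filter.Tendsto (fun k => FF S n m k) Filter.atTop (nhds 0) := by
  obtain ⟨C, hC⟩ := tmF_bound S n m
  have hb := tail_bound (tmF S n m) C (fun v hv => (hC v hv).1) (fun v hv => (hC v hv).2)
  have h2 : Filter.Tendsto (fun k : ℕ => 2 * C / ((k : ℝ) + 1)) Filter.atTop (nhds 0) := by
    have := (tendsto_one_div_add_atTop_nhds_zero_nat (𝕜 := ℝ)).const_mul (2 * C)
    rw [mul_zero] at this
    refine this.congr fun k => by ring
  exact squeeze_zero (fun k => (hb k).2.1) (fun k => (hb k).2.2) h2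

lemma FF_step (S : Finset ℕ) (n m k : ℕ) :
    FF S n m k = tmF S n m (k + 1) + FF S n m (k + 1) := by
  unfold FF
  rw [(tmF_summable S n m k).tsum_eq_zero_add]
  congr 1
  apply tsum_congr
  intro i
  congr 1
  omega

lemma zero_of_step (X : ℕ → ℝ) (h : ∀ k, X k = X (k + 1))
    (ht : Filter.Tendsto X Filter.atTop (nhds 0)) (k : ℕ) : X k = 0 := by
  have hc : ∀ k, X k = X 0 := by
    intro k
    induction k with
    | zero => rfl
    | succ k ih => rw [← h, ih]
  have : X 0 = 0 := by
    apply tendsto_nhds_unique _ ht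
    rw [show X = fun _ => X 0 from funext hc]
    exact tendsto_const_nhds
  rw [hc, this]

/-- The `Q`-step. -/
lemma FF_B (S : Finset ℕ) (n m : ℕ) (hS : m + 1 ∈ S)
    (E : ∀ v, ((n : ℝ) + 1) * (FF S (n + 1) m (v + 1) - FF S n m (v + 1)) =
      ((v : ℝ) + 1) * (FF S (n + 1) m v - FF S (n + 1) m (v + 1))) (k : ℕ) :
    FF S n (m + 1) k - FF S (n + 1) (m + 1) k =
      FF S n m k / ((k : ℝ) + n + 1) - FF S (n + 1) m k / ((n : ℝ) + 1) := by
  rw [← sub_eq_zero]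
  refine zero_of_step (fun k => FF S n (m + 1) k - FF S (n + 1) (m + 1) k -
      (FF S n m k / ((k : ℝ) + n + 1) - FF S (n + 1) m k / ((n : ℝ) + 1))) ?_ ?_ k
  · intro k
    try beta_reduce
    rw [FF_step S n (m + 1) k, FF_step S (n + 1) (m + 1) k, tmF_succ, tmF_succ, if_pos hS, if_pos hS,
      Nat.add_sub_cancel]
    have hE := E k
    push_cast
    generalize FF S n m k = a at *
    generalize FF S (n + 1) m k = b at *
    generalize FF S n m (k + 1) = c at *
    generalize FF S (n + 1) m (k + 1) = d at *
    have hc : c = d - ((k : ℝ) + 1) * (b - d) / ((n : ℝ) + 1) := by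
      field_simp
      linarith
    subst hc
    field_simp
    ring
  · have h1 := (FF_tendsto S n (m + 1)).sub (FF_tendsto S (n + 1) (m + 1))
    have h2 : Filter.Tendsto (fun k : ℕ => FF S n m k / ((k : ℝ) + n + 1)) Filter.atTop (nhds 0) := by
      refine squeeze_zero (fun k => ?_) (fun k => ?_) (FF_tendsto S n m)
      · have := FF_nonneg S n m k
        positivity
      · apply div_le_self (FF_nonneg S n m k)
        have h1 : (0 : ℝ) ≤ k := by positivity
        have h2 : (0 : ℝ) ≤ n := by positivity
        linarith
    have h3 := (FF_tendsto S (n + 1) m).div_const ((n : ℝ) + 1)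
    simpa using h1.sub (h2.sub h3)

lemma FF_E (S : Finset ℕ) (n m : ℕ) : ∀ v, ((n : ℝ) + 1) * (FF S (n + 1) m (v + 1) - FF S n m (v + 1)) =
      ((v : ℝ) + 1) * (FF S (n + 1) m v - FF S (n + 1) m (v + 1)) := by
  induction m with
  | zero =>
    have key : ∀ k, FF S n 0 k - FF S (n + 1) 0 k + 1 / ((k : ℝ) + n + 1) = 0 := by
      refine zero_of_step (fun k => FF S n 0 k - FF S (n + 1) 0 k + 1 / ((k : ℝ) + n + 1)) ?_ ?_
      · intro k
        try beta_reduce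
        rw [FF_step S n 0 k, FF_step S (n + 1) 0 k]
        simp only [tmF]
        push_cast
        field_simp
        ring
      · have h2 : Filter.Tendsto (fun k : ℕ => 1 / ((k : ℝ) + n + 1)) Filter.atTop (nhds 0) := by
          refine squeeze_zero (fun k => by positivity) (fun k => ?_)
            (tendsto_one_div_add_atTop_nhds_zero_nat (𝕜 := ℝ))
          apply one_div_le_one_div_of_le (by positivity)
          have h2 : (0 : ℝ) ≤ n := by positivity
          linarith
        simpa using ((FF_tendsto S n 0).sub (FF_tendsto S (n + 1) 0)).add h2
    intro v
    have h1 := key (v + 1)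
    have h2 : FF S (n + 1) 0 (v + 1) - FF S n 0 (v + 1) = 1 / (((v + 1 : ℕ) : ℝ) + n + 1) := by
      linarith
    rw [h2, FF_step S (n + 1) 0 v]
    simp only [tmF]
    push_cast
    field_simp
    ring
  | succ m ih =>
    intro v
    by_cases hS : m + 1 ∈ S
    · have hB := FF_B S n m hS ih (v + 1)
      have hE := ih v
      have h2 : FF S (n + 1) (m + 1) (v + 1) - FF S n (m + 1) (v + 1) =
        FF S (n + 1) m (v + 1) / ((n : ℝ) + 1) -
          FF S n m (v + 1) / (((v + 1 : ℕ) : ℝ) + n + 1) := by linarith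
      rw [h2, FF_step S (n + 1) (m + 1) v, tmF_succ, if_pos hS, Nat.add_sub_cancel]
      push_cast
      generalize FF S (n + 1) m v = b at *
      generalize FF S n m (v + 1) = c at *
      generalize FF S (n + 1) m (v + 1) = d at *
      have hc : c = d - ((v : ℝ) + 1) * (b - d) / ((n : ℝ) + 1) := by
        field_simp
        linarith
      subst hc
      field_simp
      ring
    · have key : ∀ k, FF S n (m + 1) k - FF S (n + 1) (m + 1) k
          + FF S (n + 1) m k / ((n : ℝ) + 1) = 0 := by
        refine zero_of_step (fun k => FF S n (m + 1) k - FF S (n + 1) (m + 1) k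
          + FF S (n + 1) m k / ((n : ℝ) + 1)) ?_ ?_
        · intro k
          try beta_reduce
          rw [FF_step S n (m + 1) k, FF_step S (n + 1) (m + 1) k, tmF_succ, tmF_succ, if_neg hS,
            if_neg hS]
          have hE := ih k
          push_cast
          generalize FF S (n + 1) m k = b at *
          generalize FF S n m (k + 1) = c at *
          generalize FF S (n + 1) m (k + 1) = d at *
          have hc : c = d - ((k : ℝ) + 1) * (b - d) / ((n : ℝ) + 1) := by
            field_simp
            linarith
          subst hc
          field_simp
          ring
        · simpa using ((FF_tendsto S n (m + 1)).sub (FF_tendsto S (n + 1) (m + 1))).add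
            ((FF_tendsto S (n + 1) m).div_const ((n : ℝ) + 1))
      have h1 := key (v + 1)
      have h2 : FF S (n + 1) (m + 1) (v + 1) - FF S n (m + 1) (v + 1) =
        FF S (n + 1) m (v + 1) / ((n : ℝ) + 1) := by linarith
      rw [h2, FF_step S (n + 1) (m + 1) v, tmF_succ, if_neg hS]
      push_cast
      field_simp
      ring

lemma FF_main (S : Finset ℕ) (n m : ℕ) (hS : m + 1 ∈ S) :
    FF S n (m + 1) 0 - FF S (n + 1) (m + 1) 0 =
      (1 / ((n : ℝ) + 1)) * (FF S n m 0 - FF S (n + 1) m 0) := by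
  rw [FF_B S n m hS (FF_E S n m) 0]
  push_cast
  ring

/-! ### Relating the multiple series to the nested sums -/

/-- The factor of the `j`-th variable. -/
noncomputable def phiR (S : Finset ℕ) (n j x : ℕ) : ℝ :=
  if j = 0 then (1 / (x : ℝ) - 1 / ((x : ℝ) + n))
  else if j ∈ S then 1 / ((x : ℝ) + n) else 1 / (x : ℝ)

/-- The chain condition. -/
def chainC (S : Finset ℕ) (M k : ℕ) (v : Fin M → ℕ) : Prop :=
  (∀ j, k < v j) ∧ (∀ j l : Fin M, (l : ℕ) = (j : ℕ) + 1 →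
        (if (l : ℕ) ∈ S then v l ≤ v j else v l < v j))

open Classical in
/-- The real summand. -/
noncomputable def TR (S : Finset ℕ) (n M k : ℕ) (v : Fin M → ℕ) : ℝ :=
  if chainC S M k v then ∏ j : Fin M, phiR S n j (v j) else 0

lemma phiR_nonneg (S : Finset ℕ) (n j x : ℕ) (h : 0 < x) : 0 ≤ phiR S n j x := by
  unfold phiR
  split_ifs
  · rw [sub_nonneg]
    apply one_div_le_one_div_of_le (by positivity)
    simp
  · positivity
  · positivity

lemma chainC_anti {S : Finset ℕ} {M k : ℕ} {v : Fin M → ℕ} (h : chainC S M k v) :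
    ∀ d : ℕ, ∀ j l : Fin M, (l : ℕ) = j + d → v l ≤ v j := by
  intro d
  induction d with
  | zero =>
    intro j l e
    have : l = j := Fin.ext (by simpa using e)
    rw [this]
  | succ d ih =>
    intro j l e
    have hl := l.2
    let p : Fin M := ⟨j + d, by omega⟩
    have h1 := ih j p rfl
    have h2 := h.2 p l (by simp only [p]; omega)
    split_ifs at h2 <;> omega

lemma chainC_snoc (S : Finset ℕ) (M k x : ℕ) (u : Fin M → ℕ) :
    chainC S (M + 1) k (Fin.snoc u x : Fin (M + 1) → ℕ) ↔
      k < x ∧ chainC S M (if M ∈ S then x - 1 else x) u := by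
  constructor
  · intro h
    have hx : k < x := by simpa using h.1 (Fin.last M)
    refine ⟨hx, ?_, ?_⟩
    · intro j
      have hj := j.2
      let p : Fin M := ⟨M - 1, by omega⟩
      have h1 := chainC_anti h (M - 1 - j) j.castSucc p.castSucc (by
        simp only [p, Fin.val_castSucc]; omega)
      have h2 := h.2 p.castSucc (Fin.last M) (by simp only [p, Fin.val_castSucc, Fin.val_last]; omega)
      simp only [Fin.snoc_castSucc, Fin.snoc_last, Fin.val_last] at h1 h2
      split_ifs at h2 ⊢ <;> omega
    · intro j l e
      have := h.2 j.castSucc l.castSucc (by simpa using e)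
      simpa using this
  · rintro ⟨hx, h1, h2⟩
    have hb : ∀ j, x ≤ u j := fun j => by
      have := h1 j
      split_ifs at this <;> omega
    refine ⟨?_, ?_⟩
    · intro j
      refine Fin.lastCases ?_ (fun j => ?_) j
      · simpa using hx
      · have := hb j
        simp only [Fin.snoc_castSucc]
        omega
    · intro j l
      refine Fin.lastCases ?_ (fun j => ?_) j
      · intro e
        have := l.2
        simp only [Fin.val_last] at e
        omega
      · refine Fin.lastCases ?_ (fun l => ?_) l
        · intro e
          have := h1 j
          simp only [Fin.snoc_castSucc, Fin.snoc_last, Fin.val_last]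
          split_ifs at this ⊢
          · omega
          · omega
        · intro e
          have := h2 j l (by simpa using e)
          simpa using this

lemma TR_snoc (S : Finset ℕ) (n M k x : ℕ) (u : Fin M → ℕ) :
    TR S n (M + 1) k (Fin.snoc u x : Fin (M + 1) → ℕ) =
      (if k < x then phiR S n M x else 0) * TR S n M (if M ∈ S then x - 1 else x) u := by
  have h := chainC_snoc S M k x u
  unfold TR
  by_cases hc : chainC S (M + 1) k (Fin.snoc u x : Fin (M + 1) → ℕ)
  · obtain ⟨h1, h2⟩ := h.mp hc
    rw [if_pos hc, if_pos h1, if_pos h2, Fin.prod_univ_castSucc]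
    simp [mul_comm]
  · rw [if_neg hc]
    by_cases h1 : k < x
    · have h2 : ¬ chainC S M (if M ∈ S then x - 1 else x) u := fun h2 => hc (h.mpr ⟨h1, h2⟩)
      rw [if_neg h2, mul_zero]
    · rw [if_neg h1, zero_mul]

lemma TR_nonneg (S : Finset ℕ) (n M k : ℕ) (v : Fin M → ℕ) : 0 ≤ TR S n M k v := by
  unfold TR
  split_ifs with h
  · exact Finset.prod_nonneg fun j _ => phiR_nonneg _ _ _ _ (lt_of_le_of_lt (Nat.zero_le k) (h.1 j))
  · exact le_rfl

lemma TR_hasSum_step (S : Finset ℕ) (n M : ℕ) (A : ℕ → ℝ) (hA : ∀ k, HasSum (TR S n M k) (A k))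
    (k : ℕ) (hs : Summable (fun i => phiR S n M (k + 1 + i) *
      A (if M ∈ S then k + 1 + i - 1 else k + 1 + i))) :
    HasSum (TR S n (M + 1) k) (∑' i, phiR S n M (k + 1 + i) *
      A (if M ∈ S then k + 1 + i - 1 else k + 1 + i)) := by
  let g : ℕ → ℝ := fun x => phiR S n M x * A (if M ∈ S then x - 1 else x)
  let G : ℕ → ℝ := fun x => (if k < x then phiR S n M x else 0) * A (if M ∈ S then x - 1 else x)
  have hG : HasSum G (∑' i, g (k + 1 + i)) := by
    have hinj : Function.Injective (fun i : ℕ => k + 1 + i) := fun a b h => by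
      simpa using h
    rw [← hinj.hasSum_iff]
    · convert hs.hasSum using 1
      funext i
      have : k < k + 1 + i := by omega
      simp [G, this]
    · intro x hx
      have : ¬ k < x := fun h => hx ⟨x - (k + 1), by simp only; omega⟩
      simp [G, this]
  let e : ℕ × (Fin M → ℕ) ≃ (Fin (M + 1) → ℕ) := Fin.snocEquiv (fun _ => ℕ)
  rw [← e.hasSum_iff]
  have hE : (TR S n (M + 1) k ∘ e) = fun p => (if k < p.1 then phiR S n M p.1 else 0) *
      TR S n M (if M ∈ S then p.1 - 1 else p.1) p.2 := by
    funext p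
    exact TR_snoc S n M k p.1 p.2
  have hf : ∀ x, HasSum (fun u => (TR S n (M + 1) k ∘ e) (x, u)) (G x) := by
    intro x
    rw [hE]
    exact (hA _).mul_left _
  have hsum : Summable (TR S n (M + 1) k ∘ e) := by
    refine (summable_prod_of_nonneg (f := TR S n (M + 1) k ∘ e) (fun p => TR_nonneg _ _ _ _ _)).mpr ?_
    refine ⟨fun x => (hf x).summable, ?_⟩
    simp_rw [fun x => (hf x).tsum_eq]
    exact hG.summable
  have h1 := hsum.hasSum.prod_fiberwise hf
  have := h1.unique hG
  change HasSum _ (∑' i, g (k + 1 + i))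
  rw [← this]
  exact hsum.hasSum

lemma TR_hasSum (S : Finset ℕ) (n m : ℕ) : ∀ k, HasSum (TR S n (m + 1) k) (FF S n m k) := by
  induction m with
  | zero =>
    have h0 : ∀ k, HasSum (TR S n 0 k) 1 := by
      intro k
      have : TR S n 0 k = fun _ => 1 := by
        funext v
        simp [TR, chainC]
      rw [this]
      simpa using hasSum_fintype (fun _ : Fin 0 → ℕ => (1 : ℝ))
    intro k
    have := TR_hasSum_step S n 0 (fun _ => 1) h0 k (by
      simpa [phiR, tmF] using tmF_summable S n 0 k)
    simpa [FF, phiR, tmF] using this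
  | succ m ih =>
    intro k
    have e : (fun i => phiR S n (m + 1) (k + 1 + i) *
      FF S n m (if m + 1 ∈ S then k + 1 + i - 1 else k + 1 + i)) =
        fun i => tmF S n (m + 1) (k + 1 + i) := by
      funext i
      rw [tmF_succ]
      unfold phiR
      split_ifs <;> simp_all
    have := TR_hasSum_step S n (m + 1) (FF S n m) ih k (by
      rw [e]
      exact tmF_summable S n (m + 1) k)
    rw [e] at this
    exact this

open Classical in
/-- Generic complex version of the multiple series. -/
noncomputable def GG (S : Finset ℕ) (M : ℕ) (z : ℂ) : ℂ := ∑' v : Fin M → ℕ,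
  if (∀ j, 0 < v j) ∧ (∀ j k : Fin M, (k : ℕ) = (j : ℕ) + 1 →
        (if (k : ℕ) ∈ S then v k ≤ v j else v k < v j))
  then ∏ j : Fin M, (if (j : ℕ) = 0 then (1 / (v j : ℂ) - 1 / ((v j : ℂ) + z))
             else if (j : ℕ) ∈ S then 1 / ((v j : ℂ) + z)
             else 1 / (v j : ℂ))
  else 0

lemma Gfun_eq_GG (α : List ℕ) (z : ℂ) : Gfun α z = GG (boundarySet α) α.sum z := rfl

lemma GG_eq (S : Finset ℕ) (m n : ℕ) : GG S (m + 1) (n : ℂ) = ((FF S n m 0 : ℝ) : ℂ) := by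
  rw [← (TR_hasSum S n m 0).tsum_eq, Complex.ofReal_tsum]
  unfold GG
  apply tsum_congr
  intro v
  unfold TR chainC
  split_ifs
  · push_cast
    apply Finset.prod_congr rfl
    intro j _
    unfold phiR
    split_ifs <;> push_cast <;> rfl
  · simp

lemma GG_congr (S S' : Finset ℕ) (M : ℕ) (z : ℂ) (h : ∀ j, j < M → (j ∈ S ↔ j ∈ S')) :
    GG S M z = GG S' M z := by
  unfold GG
  apply tsum_congr
  intro v
  have h' : ∀ j : Fin M, ((j : ℕ) ∈ S ↔ (j : ℕ) ∈ S') := fun j => h j j.2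
  simp only [h']

lemma mem_boundarySet_append (β : List ℕ) (hβ : β ≠ []) (a x : ℕ) :
    x ∈ boundarySet (β ++ [a]) ↔ x ∈ boundarySet β ∨ x = β.sum := by
  have h1 : ∀ (a : ℕ) (l : List ℕ) (c : ℕ), List.scanl (· + ·) c (l ++ [a]) =
      List.scanl (· + ·) c l ++ [c + l.sum + a] := by
    intro a l
    induction l with
    | nil => intro c; simp
    | cons b t ih => intro c; simp [ih, add_assoc]
  have h4 : ∀ (a : ℕ) (l : List ℕ), (List.scanl (· + ·) 0 (l ++ [a])).drop 1
      = (List.scanl (· + ·) 0 l).drop 1 ++ [0 + l.sum + a] := by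
    intro a l
    rw [h1, List.drop_append_of_le_length (by simp)]
  have h2 : (List.scanl (· + ·) 0 β).drop 1 =
      ((List.scanl (· + ·) 0 β).drop 1).dropLast ++ [β.sum] := by
    rcases List.eq_nil_or_concat β with h | ⟨γ, b, h⟩
    · exact absurd h hβ
    · rw [h, List.concat_eq_append, h4 b γ]
      simp
  unfold boundarySet
  rw [h4, List.dropLast_concat, h2]
  simp [or_comm]

theorem Gfun_diff_of_last_eq_one (α : List ℕ) (hα : MIdx α) (hw : 2 ≤ α.sum)
    (hlast : α.getLastD 0 = 1) (n : ℕ) :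
    Gfun α n - Gfun α ((n : ℂ) + 1) =
      (1 / ((n : ℂ) + 1)) * (Gfun (rminus α) n - Gfun (rminus α) ((n : ℂ) + 1)) := by
  have hr : rminus α = α.dropLast := by
    unfold rminus
    rw [hlast]
    simp
  rw [hr]
  have hα' : α = α.dropLast ++ [1] := by
    have h1 := List.dropLast_append_getLast hα.1
    have h2 : α.getLast hα.1 = 1 := by
      rw [List.getLastD_eq_getLast?, List.getLast?_eq_getLast_of_ne_nil hα.1] at hlast
      exact hlast
    rw [h2] at h1
    exact h1.symm
  generalize α.dropLast = β at hα'
  subst hα'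
  have hsum : (β ++ [1]).sum = β.sum + 1 := by simp
  rw [hsum] at hw
  have hβ : β ≠ [] := by
    rintro rfl
    simp at hw
  obtain ⟨m, hm⟩ : ∃ m, β.sum = m + 1 := ⟨β.sum - 1, by omega⟩
  have hc : ∀ z, Gfun β z = GG (boundarySet (β ++ [1])) (m + 1) z := by
    intro z
    rw [Gfun_eq_GG, hm]
    apply GG_congr
    intro j hj
    rw [mem_boundarySet_append β hβ]
    have : j ≠ β.sum := by omega
    simp [this]
  have hS : m + 1 ∈ boundarySet (β ++ [1]) := by
    rw [mem_boundarySet_append β hβ, hm]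
    exact Or.inr rfl
  rw [hc, hc, Gfun_eq_GG, Gfun_eq_GG, hsum, hm]
  have hn : (n : ℂ) + 1 = ((n + 1 : ℕ) : ℂ) := by push_cast; rfl
  have key := congrArg (fun x : ℝ => (x : ℂ)) (FF_main _ n m hS)
  simp only [Complex.ofReal_mul, Complex.ofReal_sub, Complex.ofReal_div, Complex.ofReal_add,
    Complex.ofReal_one, Complex.ofReal_natCast] at key
  rw [← GG_eq, ← GG_eq, ← GG_eq, ← GG_eq] at key
  rw [← hn] at key
  exact key
end
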